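/- arXiv:2304.01451 — 6 statements merged into one kernel-verified Lean document; each statement's English description precedes it below -/
import Mathlib

section
/- Let v be a 1-Lipschitz q-partitioning valuation over [m], and let S ⊆ [m] be a random set in which each element appears independently. Then for any a ≥ 0, k ≥ 0, integers 1 ≤ s < r ≤ log₂ q, and any real α ≥ 1/s: P[ v(S) ≥ (r/s)·a + k ] ≤ t(α,r,s)^{−k} · P[v(S) ≤ a]^{−αr}, where t(α,r,s) denotes the larger root of the equation t + αr·t^{−1/(αs)} = αr + 1. -/
open Finset

/-- A normalized monotone valuation `v : 2^[m] → ℝ≥0`. -/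
def IsValuation (m : ℕ) (v : Finset (Fin m) → ℝ) : Prop :=
  v ∅ = 0 ∧ (∀ S T : Finset (Fin m), S ⊆ T → v S ≤ v T) ∧ ∀ S, 0 ≤ v S

/-- A fractional cover of `[q]`. -/
def IsFractionalCover (q : ℕ) (α : Finset (Fin q) → ℝ) : Prop :=
  (∀ T, 0 ≤ α T) ∧
    ∀ j : Fin q, 1 ≤ ∑ T ∈ Finset.univ.filter (fun T : Finset (Fin q) => j ∈ T), α T

/-- `P` is a partition of `S` into `q` (possibly empty) pairwise disjoint parts. -/
def IsPartitionInto (m q : ℕ) (S : Finset (Fin m)) (P : Fin q → Finset (Fin m)) : Prop :=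
  (∀ i j : Fin q, i ≠ j → Disjoint (P i) (P j)) ∧ Finset.univ.biUnion P = S

/-- `v` is `q`-partitioning, i.e. `v ∈ Q(q,[m])`. -/
def IsQPartitioning (m q : ℕ) (v : Finset (Fin m) → ℝ) : Prop :=
  ∀ S P, IsPartitionInto m q S P → ∀ α, IsFractionalCover q α →
    v S ≤ ∑ T : Finset (Fin q), α T * v (T.biUnion P)

open scoped Classical ENNReal

/-- Probability that the random set (each `j` included independently with probability `p j`)
equals `S`. -/
noncomputable def prodWeight (m : ℕ) (p : Fin m → ℝ) (S : Finset (Fin m)) : ℝ :=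
  (∏ j ∈ S, p j) * ∏ j ∈ Sᶜ, (1 - p j)

/-- `v` is 1-Lipschitz: all marginal values are at most 1. -/
def IsLipschitzVal (m : ℕ) (v : Finset (Fin m) → ℝ) : Prop :=
  ∀ (S : Finset (Fin m)) (i : Fin m), v (insert i S) - v S ≤ 1

section Analytic

variable {s r : ℕ} {α t : ℝ}

/-- For reals in `[0, 1]` along `Fin r`, some `s` indices carry the `s` largest values. -/
theorem exists_card_eq_forall_le (g : Fin r → ℝ) (hs : 1 ≤ s) (hsr : s ≤ r) :
    ∃ I : Finset (Fin r), I.card = s ∧ ∃ i₀ ∈ I, (∀ i ∈ I, g i₀ ≤ g i) ∧ ∀ i ∉ I, g i ≤ g i₀ := by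
  induction s, hs using Nat.le_induction with
  | base =>
    obtain ⟨i₀, -, h⟩ := Finset.exists_max_image (Finset.univ : Finset (Fin r)) g
      ⟨⟨0, by omega⟩, Finset.mem_univ _⟩
    exact ⟨{i₀}, by simp, i₀, by simp, by simp, fun i _ => h i (Finset.mem_univ _)⟩
  | succ n hn ih =>
    obtain ⟨I, hI, i₀, hi₀, h1, h2⟩ := ih (by omega)
    have hne : (Iᶜ).Nonempty := by
      rw [← Finset.card_pos, Finset.card_compl, Fintype.card_fin]
      omega
    obtain ⟨i₁, hi₁, h⟩ := Finset.exists_max_image Iᶜ g hne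
    rw [Finset.mem_compl] at hi₁
    refine ⟨insert i₁ I, by rw [Finset.card_insert_of_notMem hi₁, hI], i₁, by simp, ?_, ?_⟩
    · intro i hi
      rcases Finset.mem_insert.1 hi with rfl | hi
      · exact le_rfl
      · exact (h2 i₁ hi₁).trans (h1 i hi)
    · intro i hi
      rw [Finset.mem_insert, not_or] at hi
      exact h i (Finset.mem_compl.2 hi.2)

/-- Convexity of the exponential along the segment from `0` to `x`. -/
theorem exp_mul_le_chord {l : ℝ} (h0 : 0 ≤ l) (h1 : l ≤ 1) (x : ℝ) :
    Real.exp (l * x) ≤ 1 - l + l * Real.exp x := by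
  have h := convexOn_exp.2 (Set.mem_univ 0) (Set.mem_univ x) (sub_nonneg.2 h1) h0 (by ring)
  simpa using h

theorem div_le_root (hs : 1 ≤ s) (hsr : s < r) (hα : 1 / (s : ℝ) ≤ α) (ht1 : 1 < t)
    (ht : t + α * r * t ^ (-(1 / (α * s))) = α * r + 1) :
    (s : ℝ) / r ≤ t ^ (-(1 / (α * s))) := by
  have hs0 : (0 : ℝ) < s := by exact_mod_cast hs
  have hr0 : (0 : ℝ) < r := by exact_mod_cast (by omega : 0 < r)
  have hsr' : (s : ℝ) < r := by exact_mod_cast hsr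
  have hα0 : 0 < α := lt_of_lt_of_le (by positivity) hα
  have hβ : 1 ≤ α * s := by rwa [div_le_iff₀ hs0] at hα
  set u := t ^ (-(1 / (α * s))) with hu
  have hu0 : 0 < u := by positivity
  have hlogu : α * s * Real.log u = -Real.log t := by
    rw [hu, Real.log_rpow (by linarith)]
    field_simp
  by_contra! hlt
  have hx1 : (s : ℝ) / r < 1 := (div_lt_one hr0).2 hsr'
  set x := (s : ℝ) / r with hx
  have hx0 : 0 < x := by positivity
  set l := (1 - x) / (1 - u) with hl
  have hl0 : 0 < l := div_pos (by linarith) (by linarith)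
  have hl1 : l < 1 := (div_lt_one (by linarith)).2 (by linarith)
  have hlu : l * (1 - u) = 1 - x := div_mul_cancel₀ _ (by linarith)
  have hlog : l * Real.log u < Real.log x := by
    have h := strictConcaveOn_log_Ioi.2 (Set.mem_Ioi.2 hu0) (Set.mem_Ioi.2 one_pos)
      (by linarith) hl0 (sub_pos.2 hl1) (by ring)
    have he : l * u + (1 - l) = x := by linarith
    simpa [he] using h
  have h1 : Real.exp (-(α * s * Real.log x)) < 1 + l * (t - 1) := by
    have h2 : -(α * s * Real.log x) < l * Real.log t := by
      nlinarith [mul_lt_mul_of_pos_left hlog (by positivity : 0 < α * s)]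
    have h3 := exp_mul_le_chord hl0.le hl1.le (Real.log t)
    rw [Real.exp_log (by linarith)] at h3
    linarith [Real.exp_lt_exp.2 h2]
  have h2 : 1 + α * s * (1 / x - 1) ≤ Real.exp (-(α * s * Real.log x)) := by
    have h := one_add_mul_self_le_rpow_one_add (s := 1 / x - 1) (p := α * s)
      (by have : 0 < 1 / x := by positivity
          linarith) hβ
    rw [show 1 + (1 / x - 1) = x⁻¹ by ring, Real.rpow_def_of_pos (by positivity),
      Real.log_inv] at h
    convert h using 2
    ring
  have h3 : α * s * (1 / x - 1) = α * r * (1 - x) := by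
    rw [hx]
    field_simp
  have h4 : t - 1 = α * r * (1 - u) := by linarith
  rw [h3] at h2
  rw [h4, ← hlu] at *
  nlinarith

theorem root_le_of_le (hs : 1 ≤ s) (hsr : s < r) (hα : 1 / (s : ℝ) ≤ α) (ht1 : 1 < t)
    (ht : t + α * r * t ^ (-(1 / (α * s))) = α * r + 1) {j : ℝ} (hj0 : 0 < j) (hjs : j ≤ s) :
    t ≤ 1 + α * (r - s + j) * (1 - Real.exp (-(Real.log t / α / j))) := by
  have hs0 : (0 : ℝ) < s := by exact_mod_cast hs
  have hr0 : (0 : ℝ) < r := by exact_mod_cast (by omega : 0 < r)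
  have hsr' : (s : ℝ) < r := by exact_mod_cast hsr
  have hα0 : 0 < α := lt_of_lt_of_le (by positivity) hα
  have hxu := div_le_root hs hsr hα ht1 ht
  have hu1 : t ^ (-(1 / (α * s))) < 1 :=
    Real.rpow_lt_one_of_one_lt_of_neg ht1 (by simp; positivity)
  have hexp : Real.exp (-(Real.log t / α / j)) = (t ^ (-(1 / (α * s)))) ^ ((s : ℝ) / j) := by
    rw [← Real.rpow_mul (by linarith), Real.rpow_def_of_pos (by linarith)]
    congr 1
    field_simp
  rw [hexp]
  set u := t ^ (-(1 / (α * s))) with hu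
  have hx1 : (s : ℝ) / r < 1 := (div_lt_one hr0).2 hsr'
  have hγ : 1 ≤ (s : ℝ) / j := (one_le_div hj0).2 hjs
  have hrs : 0 < r - s + j := by linarith
  have hber : ((s : ℝ) / r) ^ ((s : ℝ) / j) ≤ j / (r - s + j) := by
    have h := one_add_mul_self_le_rpow_one_add (s := (r : ℝ) / s - 1) (p := (s : ℝ) / j)
      (by have : 0 < (r : ℝ) / s := by positivity
          linarith) hγ
    rw [show 1 + ((r : ℝ) / s - 1) = r / s by ring,
      show 1 + (s : ℝ) / j * (r / s - 1) = (r - s + j) / j by field_simp; ring] at h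
    have h' := inv_anti₀ (by positivity) h
    rwa [← Real.inv_rpow (by positivity), inv_div, inv_div] at h'
  set x := (s : ℝ) / r with hx
  set l := (1 - u) / (1 - x) with hl
  have hl0 : 0 ≤ l := div_nonneg (by linarith) (by linarith)
  have hl1 : l ≤ 1 := (div_le_one (by linarith)).2 (by linarith)
  have hlx : l * (1 - x) = 1 - u := div_mul_cancel₀ _ (by linarith)
  have hconv : u ^ ((s : ℝ) / j) ≤ l * x ^ ((s : ℝ) / j) + (1 - l) := by
    have h := (convexOn_rpow hγ).2 (Set.mem_Ici.2 (by positivity : (0 : ℝ) ≤ x))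
      (Set.mem_Ici.2 zero_le_one) hl0 (sub_nonneg.2 hl1) (by ring)
    have he : l * x + (1 - l) = u := by linarith
    simpa [he] using h
  have h1 : u ^ ((s : ℝ) / j) ≤ l * (j / (r - s + j)) + (1 - l) :=
    hconv.trans (by gcongr)
  have h2 : (r - s + j) * u ^ ((s : ℝ) / j) ≤ l * j + (r - s + j) * (1 - l) := by
    refine (mul_le_mul_of_nonneg_left h1 hrs.le).trans_eq ?_
    field_simp
  have h3 : r * (1 - u) = l * (r - s) := by
    rw [← hlx, hx]
    field_simp
  have h4 : t = 1 + α * (l * (r - s)) := by rw [← h3]; linarith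
  have h5 : l * (r - s) ≤ (r - s + j) * (1 - u ^ ((s : ℝ) / j)) := by linarith
  have h6 := mul_le_mul_of_nonneg_left h5 hα0.le
  linarith

theorem min_root_exp_le (hs : 1 ≤ s) (hsr : s < r) (hα : 1 / (s : ℝ) ≤ α) (ht1 : 1 < t)
    (ht : t + α * r * t ^ (-(1 / (α * s))) = α * r + 1) {j Z : ℝ} (hj0 : 0 < j) (hjs : j ≤ s)
    (hZ : 0 ≤ Z) :
    min t (Real.exp (α * Z)) ≤ 1 + α * (r - s + j) * (1 - Real.exp (-(Z / j))) := by
  have hs0 : (0 : ℝ) < s := by exact_mod_cast hs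
  have hsr' : (s : ℝ) < r := by exact_mod_cast hsr
  have hα0 : 0 < α := lt_of_lt_of_le (by positivity) hα
  have hroot := root_le_of_le hs hsr hα ht1 ht hj0 hjs
  have hc : 0 < α * (r - s + j) := mul_pos hα0 (by linarith)
  have hlt : 0 < Real.log t := Real.log_pos ht1
  set W := Real.log t / α with hW
  have hW0 : 0 < W := by positivity
  rcases le_total W Z with h | h
  · refine (min_le_left _ _).trans (hroot.trans ?_)
    gcongr
  · refine (min_le_right _ _).trans ?_
    have hl0 : 0 ≤ Z / W := by positivity
    have hl1 : Z / W ≤ 1 := (div_le_one hW0).2 h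
    have h1 := exp_mul_le_chord hl0 hl1 (Real.log t)
    have h2 := exp_mul_le_chord hl0 hl1 (-(W / j))
    rw [Real.exp_log (by linarith),
      show Z / W * Real.log t = α * Z by rw [hW]; field_simp] at h1
    rw [show Z / W * -(W / j) = -(Z / j) by field_simp] at h2
    have h3 := mul_le_mul_of_nonneg_left hroot hl0
    have h4 := mul_le_mul_of_nonneg_left h2 hc.le
    linarith

/-- The one-coordinate estimate: either `t` or the inverse power of a product of `s` of the
numbers `g i` is bounded by the linear expression `1 + α ∑ (1 - g i)`. -/
theorem root_le_or_exists_prod_le (hs : 1 ≤ s) (hsr : s < r) (hα : 1 / (s : ℝ) ≤ α)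
    (ht1 : 1 < t) (ht : t + α * r * t ^ (-(1 / (α * s))) = α * r + 1)
    (g : Fin r → ℝ) (hg0 : ∀ i, 0 ≤ g i) (hg1 : ∀ i, g i ≤ 1) :
    t ≤ 1 + α * ∑ i, (1 - g i) ∨
      ∃ I : Finset (Fin r), I.card = s ∧ (∀ i ∈ I, 0 < g i) ∧
        ∏ i ∈ I, g i ^ (-α) ≤ 1 + α * ∑ i, (1 - g i) := by
  have hs0 : (0 : ℝ) < s := by exact_mod_cast hs
  have hsr' : (s : ℝ) < r := by exact_mod_cast hsr
  have hα0 : 0 < α := lt_of_lt_of_le (by positivity) hα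
  obtain ⟨I, hI, i₀, hi₀, hmin, hmax⟩ := exists_card_eq_forall_le g hs hsr.le
  have hcompl : (r - s) * (1 - g i₀) ≤ ∑ i ∈ Iᶜ, (1 - g i) := by
    have h := Finset.card_nsmul_le_sum Iᶜ (fun i => 1 - g i) (1 - g i₀)
      (fun i hi => by linarith [hmax i (Finset.mem_compl.1 hi)])
    rw [Finset.card_compl, Fintype.card_fin, hI, nsmul_eq_mul, Nat.cast_sub hsr.le] at h
    exact h
  have hsplit : ∑ i, (1 - g i) = ∑ i ∈ I, (1 - g i) + ∑ i ∈ Iᶜ, (1 - g i) :=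
    (Finset.sum_add_sum_compl I _).symm
  rcases (hg0 i₀).eq_or_lt with hM | hM
  · left
    have h1 : 1 ≤ ∑ i ∈ I, (1 - g i) := by
      have h := Finset.single_le_sum (f := fun i => 1 - g i)
        (fun i _ => by linarith [hg1 i]) hi₀
      simpa [← hM] using h
    have h2 := root_le_of_le hs hsr hα ht1 ht one_pos (by exact_mod_cast hs)
    rw [← hM] at hcompl
    refine h2.trans ?_
    have h3 : ((r : ℝ) - s + 1) * (1 - Real.exp (-(Real.log t / α / 1))) ≤ ∑ i, (1 - g i) := by
      have := Real.exp_pos (-(Real.log t / α / 1))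
      nlinarith
    rw [mul_assoc]
    gcongr
  · have hpos : ∀ i ∈ I, 0 < g i := fun i hi => hM.trans_le (hmin i hi)
    have hnn : ∀ i ∈ I, 0 ≤ -Real.log (g i) := fun i _ => by
      linarith [Real.log_nonpos (hg0 i) (hg1 i)]
    set Z := ∑ i ∈ I, -Real.log (g i) with hZdef
    have hprod : ∏ i ∈ I, g i ^ (-α) = Real.exp (α * Z) := by
      rw [hZdef, Finset.mul_sum, Real.exp_sum]
      refine Finset.prod_congr rfl fun i hi => ?_
      rw [Real.rpow_def_of_pos (hpos i hi)]
      congr 1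
      ring
    rcases (hg1 i₀).eq_or_lt with hM1 | hM1
    · right
      refine ⟨I, hI, hpos, ?_⟩
      have h1 : ∏ i ∈ I, g i ^ (-α) = 1 := Finset.prod_eq_one fun i hi => by
        have : g i = 1 := le_antisymm (hg1 i) (hM1 ▸ hmin i hi)
        simp [this]
      have h2 : 0 ≤ ∑ i, (1 - g i) := Finset.sum_nonneg fun i _ => by linarith [hg1 i]
      rw [h1]
      nlinarith
    · set L := -Real.log (g i₀) with hL
      have hL0 : 0 < L := by linarith [Real.log_neg hM hM1]
      have hLZ : L ≤ Z := Finset.single_le_sum hnn hi₀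
      have hzL : ∀ i ∈ I, -Real.log (g i) ≤ L := fun i hi =>
        neg_le_neg (Real.log_le_log hM (hmin i hi))
      have hZs : Z ≤ s * L := by
        have h := Finset.sum_le_card_nsmul I _ L hzL
        rwa [hI, nsmul_eq_mul] at h
      have hZ0 : 0 < Z := hL0.trans_le hLZ
      have hmain := min_root_exp_le hs hsr hα ht1 ht (j := Z / L) (Z := Z) (by positivity)
        ((div_le_iff₀ hL0).2 hZs) hZ0.le
      have hMe : Real.exp (-(Z / (Z / L))) = g i₀ := by
        rw [show Z / (Z / L) = L by field_simp, hL, neg_neg, Real.exp_log hM]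
      rw [hMe] at hmain
      have hchord : ∑ i ∈ I, (-Real.log (g i) / L) * (1 - g i₀) ≤ ∑ i ∈ I, (1 - g i) := by
        refine Finset.sum_le_sum fun i hi => ?_
        have h := exp_mul_le_chord (l := -Real.log (g i) / L) (div_nonneg (hnn i hi) hL0.le)
          ((div_le_one hL0).2 (hzL i hi)) (-L)
        rw [show -Real.log (g i) / L * -L = Real.log (g i) by field_simp,
          Real.exp_log (hpos i hi), hL, neg_neg, Real.exp_log hM, ← hL] at h
        linarith
      rw [← Finset.sum_mul, ← Finset.sum_div] at hchord
      have hle : 1 + α * (r - s + Z / L) * (1 - g i₀) ≤ 1 + α * ∑ i, (1 - g i) := by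
        rw [mul_assoc]
        gcongr
        rw [hsplit]
        linarith
      rcases min_le_iff.1 (hmain.trans hle) with h | h
      · exact Or.inl h
      · exact Or.inr ⟨I, hI, hpos, hprod ▸ h⟩

theorem one_add_sum_le_prod_rpow_neg (hα0 : 0 ≤ α) (x : Fin r → ℝ) (hx : ∀ i, 0 < x i) :
    1 + α * ∑ i, (1 - x i) ≤ ∏ i, x i ^ (-α) := by
  have h : ∏ i, x i ^ (-α) = Real.exp (α * ∑ i, -Real.log (x i)) := by
    rw [Finset.mul_sum, Real.exp_sum]
    refine Finset.prod_congr rfl fun i _ => ?_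
    rw [Real.rpow_def_of_pos (hx i)]
    congr 1
    ring
  have h1 : ∑ i, (1 - x i) ≤ ∑ i, -Real.log (x i) := Finset.sum_le_sum fun i _ => by
    linarith [Real.log_le_sub_one_of_pos (hx i)]
  rw [h]
  have h2 := Real.add_one_le_exp (α * ∑ i, -Real.log (x i))
  have h3 := mul_le_mul_of_nonneg_left h1 hα0
  linarith

end Analytic

section ProductMeasure

variable {ι : Type*} {p : ι → ℝ}

/-- Weight of `S` under independent sampling of the elements of `U`. -/
noncomputable def sampleWeight (p : ι → ℝ) (U S : Finset ι) : ℝ :=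
  ∏ j ∈ U, if j ∈ S then p j else 1 - p j

/-- Probability of the event `A` under independent sampling of the elements of `U`. -/
noncomputable def sampleProb (p : ι → ℝ) (U : Finset ι) (A : Finset ι → Prop) : ℝ :=
  ∑ S ∈ U.powerset, if A S then sampleWeight p U S else 0

theorem sampleWeight_nonneg (hp : ∀ j, 0 ≤ p j ∧ p j ≤ 1) (U S : Finset ι) :
    0 ≤ sampleWeight p U S :=
  Finset.prod_nonneg fun j _ => by
    have := hp j
    split_ifs <;> linarith

theorem sampleWeight_insert_left {U S : Finset ι} {j : ι} (hj : j ∉ U) (hS : j ∉ S) :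
    sampleWeight p (insert j U) S = (1 - p j) * sampleWeight p U S := by
  simp [sampleWeight, Finset.prod_insert hj, hS]

theorem sampleWeight_insert_insert {U : Finset ι} (S : Finset ι) {j : ι} (hj : j ∉ U) :
    sampleWeight p (insert j U) (insert j S) = p j * sampleWeight p U S := by
  rw [sampleWeight, Finset.prod_insert hj, if_pos (Finset.mem_insert_self _ _), sampleWeight]
  congr 1
  refine Finset.prod_congr rfl fun x hx => ?_
  have : x ≠ j := fun h => hj (h ▸ hx)
  simp [Finset.mem_insert, this]

theorem sum_sampleWeight_insert {U : Finset ι} {j : ι} (hj : j ∉ U) (F : Finset ι → ℝ) :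
    ∑ S ∈ (insert j U).powerset, sampleWeight p (insert j U) S * F S =
      (1 - p j) * ∑ S ∈ U.powerset, sampleWeight p U S * F S +
        p j * ∑ S ∈ U.powerset, sampleWeight p U S * F (insert j S) := by
  rw [Finset.sum_powerset_insert hj, Finset.mul_sum, Finset.mul_sum]
  congr 1
  · refine Finset.sum_congr rfl fun S hS => ?_
    rw [sampleWeight_insert_left hj fun h => hj (Finset.mem_powerset.1 hS h), mul_assoc]
  · refine Finset.sum_congr rfl fun S _ => ?_
    rw [sampleWeight_insert_insert S hj, mul_assoc]

theorem sampleProb_eq_sum_mul (U : Finset ι) (A : Finset ι → Prop) :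
    sampleProb p U A = ∑ S ∈ U.powerset, sampleWeight p U S * if A S then 1 else 0 := by
  simp [sampleProb]

theorem sampleProb_insert {U : Finset ι} {j : ι} (hj : j ∉ U) (A : Finset ι → Prop) :
    sampleProb p (insert j U) A =
      (1 - p j) * sampleProb p U A + p j * sampleProb p U fun S => A (insert j S) := by
  simp only [sampleProb_eq_sum_mul]
  exact sum_sampleWeight_insert hj _

theorem sampleProb_mono (hp : ∀ j, 0 ≤ p j ∧ p j ≤ 1) (U : Finset ι) {A B : Finset ι → Prop}
    (h : ∀ S, A S → B S) : sampleProb p U A ≤ sampleProb p U B := by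
  refine Finset.sum_le_sum fun S _ => ?_
  have := sampleWeight_nonneg hp U S
  by_cases hA : A S
  · simp [hA, h S hA]
  · rw [if_neg hA]
    split_ifs <;> simp [this]

theorem sampleProb_nonneg (hp : ∀ j, 0 ≤ p j ∧ p j ≤ 1) (U : Finset ι) (A : Finset ι → Prop) :
    0 ≤ sampleProb p U A :=
  Finset.sum_nonneg fun S _ => by
    have := sampleWeight_nonneg hp U S
    split_ifs <;> simp [this]

/-- The elements of `S` that lie in fewer than `s` of the sets `T i`. -/
noncomputable def sparsePart {r : ℕ} (s : ℕ) (S : Finset ι) (T : Fin r → Finset ι) : Finset ι :=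
  S.filter fun j => (Finset.univ.filter fun i => j ∈ T i).card < s

theorem sparsePart_congr {r s : ℕ} {S : Finset ι} {T T' : Fin r → Finset ι}
    (h : ∀ x ∈ S, ∀ i, x ∈ T' i ↔ x ∈ T i) : sparsePart s S T' = sparsePart s S T := by
  refine Finset.filter_congr fun x hx => ?_
  simp only [h x hx]

/-- Talagrand's control by several points, in exponential-moment form. -/
theorem sum_sampleWeight_mul_rpow_le {s r : ℕ} {α t : ℝ} (hs : 1 ≤ s) (hsr : s < r)
    (hα : 1 / (s : ℝ) ≤ α) (ht1 : 1 < t)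
    (ht : t + α * r * t ^ (-(1 / (α * s))) = α * r + 1)
    (hp : ∀ j, 0 ≤ p j ∧ p j ≤ 1) (U : Finset ι) (A : Fin r → Finset ι → Prop)
    (f : Finset ι → ℝ) (hA : ∀ i, 0 < sampleProb p U (A i))
    (hf : ∀ S ⊆ U, ∀ T : Fin r → Finset ι, (∀ i, T i ⊆ U) → (∀ i, A i (T i)) →
      f S ≤ (sparsePart s S T).card) :
    ∑ S ∈ U.powerset, sampleWeight p U S * t ^ f S ≤ ∏ i, sampleProb p U (A i) ^ (-α) := by
  have hs0 : (0 : ℝ) < s := by exact_mod_cast hs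
  have hα0 : 0 < α := lt_of_lt_of_le (by positivity) hα
  have ht0 : 0 < t := by linarith
  induction U using Finset.induction_on generalizing A f with
  | empty =>
    have hA' : ∀ i, A i ∅ := fun i => by
      by_contra h
      have := hA i
      simp [sampleProb, h] at this
    have h := hf ∅ subset_rfl (fun _ => ∅) (fun _ => subset_rfl) hA'
    have h0 : f ∅ ≤ 0 := by simpa [sparsePart] using h
    have h1 : ∀ i, sampleProb p ∅ (A i) = 1 := fun i => by
      rw [sampleProb, Finset.powerset_empty, Finset.sum_singleton, if_pos (hA' i), sampleWeight,
        Finset.prod_empty]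
    simpa [h1, sampleWeight] using Real.rpow_le_one_of_one_le_of_nonpos ht1.le h0
  | insert j U hj ih =>
    set B : Fin r → Finset ι → Prop := fun i S => A i S ∨ A i (insert j S) with hB
    set b : Fin r → ℝ := fun i => sampleProb p U (B i) with hb
    set c : Fin r → ℝ := fun i => sampleProb p U fun S => A i (insert j S) with hc
    have hcb : ∀ i, c i ≤ b i := fun i => sampleProb_mono hp U fun S h => Or.inr h
    have hab : ∀ i, sampleProb p U (A i) ≤ b i := fun i => sampleProb_mono hp U fun S h => Or.inl h
    have hc0 : ∀ i, 0 ≤ c i := fun i => sampleProb_nonneg hp U _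
    have hpj := hp j
    have hAb : ∀ i, sampleProb p (insert j U) (A i) ≤ (1 - p j) * b i + p j * c i := fun i => by
      rw [sampleProb_insert hj]
      have := mul_le_mul_of_nonneg_left (hab i) (sub_nonneg.2 hpj.2)
      linarith
    have hb0 : ∀ i, 0 < b i := fun i => by
      have h1 := hA i
      have h2 := hAb i
      have h3 := mul_le_mul_of_nonneg_left (hcb i) hpj.1
      linarith
    have hlift : ∀ (I : Finset (Fin r)) (T : Fin r → Finset ι), (∀ i, T i ⊆ U) →
        (∀ i, B i (T i)) → (∀ i ∈ I, A i (insert j (T i))) →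
        ∃ T' : Fin r → Finset ι, (∀ i, T' i ⊆ insert j U) ∧ (∀ i, A i (T' i)) ∧
          (∀ i ∈ I, j ∈ T' i) ∧ ∀ S ⊆ U, sparsePart s S T' = sparsePart s S T := by
      intro I T hTU hTB hTI
      refine ⟨fun i => if A i (insert j (T i)) then insert j (T i) else T i, ?_, ?_, ?_, ?_⟩
      · intro i
        dsimp only
        split_ifs
        · exact Finset.insert_subset_insert _ (hTU i)
        · exact (hTU i).trans (Finset.subset_insert _ _)
      · intro i
        dsimp only
        split_ifs with h
        · exact h
        · exact (hTB i).resolve_right h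
      · intro i hi
        simp [hTI i hi]
      · intro S hS
        refine sparsePart_congr fun x hx i => ?_
        have hxj : x ≠ j := fun h => hj (h ▸ hS hx)
        split_ifs <;> simp [hxj]
    have h0 : ∑ S ∈ U.powerset, sampleWeight p U S * t ^ f S ≤ ∏ i, b i ^ (-α) := by
      refine ih B f hb0 fun S hS T hTU hTB => ?_
      obtain ⟨T', h1, h2, -, h4⟩ := hlift ∅ T hTU hTB (by simp)
      rw [← h4 S hS]
      exact hf S (hS.trans (Finset.subset_insert _ _)) T' h1 h2
    have h1 : ∑ S ∈ U.powerset, sampleWeight p U S * t ^ f (insert j S) ≤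
        t * ∏ i, b i ^ (-α) := by
      have h := ih B (fun S => f (insert j S) - 1) hb0 fun S hS T hTU hTB => by
        obtain ⟨T', h1, h2, -, h4⟩ := hlift ∅ T hTU hTB (by simp)
        rw [← h4 S hS]
        have h5 := hf (insert j S) (Finset.insert_subset_insert _ hS) T' h1 h2
        have h6 : (sparsePart s (insert j S) T').card ≤ (sparsePart s S T').card + 1 := by
          refine (Finset.card_le_card ?_).trans (Finset.card_insert_le j _)
          intro x
          simp only [sparsePart, Finset.mem_filter, Finset.mem_insert]
          tauto
        have h7 : ((sparsePart s (insert j S) T').card : ℝ) ≤ (sparsePart s S T').card + 1 := by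
          exact_mod_cast h6
        linarith
      refine le_trans (le_of_eq ?_) (mul_le_mul_of_nonneg_left h ht0.le)
      rw [Finset.mul_sum]
      refine Finset.sum_congr rfl fun S _ => ?_
      rw [Real.rpow_sub_one ht0.ne']
      field_simp
    have h2 : ∀ I : Finset (Fin r), I.card = s → (∀ i ∈ I, 0 < c i) →
        ∑ S ∈ U.powerset, sampleWeight p U S * t ^ f (insert j S) ≤
          (∏ i ∈ I, (c i / b i) ^ (-α)) * ∏ i, b i ^ (-α) := by
      intro I hI hcI
      have h := ih (fun i => if i ∈ I then fun S => A i (insert j S) else B i)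
        (fun S => f (insert j S))
        (fun i => by
          split_ifs with hi
          · exact hcI i hi
          · exact hb0 i)
        fun S hS T hTU hTC => by
          obtain ⟨T', h1, h2, h3, h4⟩ := hlift I T hTU
            (fun i => by
              have := hTC i
              split_ifs at this
              · exact Or.inr this
              · exact this)
            (fun i hi => by simpa [hi] using hTC i)
          rw [← h4 S hS]
          refine (hf (insert j S) (Finset.insert_subset_insert _ hS) T' h1 h2).trans ?_
          have hjs : ¬ (Finset.univ.filter fun i => j ∈ T' i).card < s := by
            rw [not_lt, ← hI]
            exact Finset.card_le_card fun i hi => by simpa using h3 i hi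
          have : sparsePart s (insert j S) T' = sparsePart s S T' := by
            rw [sparsePart, Finset.filter_insert, if_neg hjs, sparsePart]
          rw [this]
      refine h.trans (le_of_eq ?_)
      rw [← Finset.prod_mul_prod_compl I, ← Finset.prod_mul_prod_compl I fun i => b i ^ (-α),
        ← mul_assoc, ← Finset.prod_mul_distrib]
      congr 1
      · refine Finset.prod_congr rfl fun i hi => ?_
        rw [if_pos hi, ← Real.mul_rpow (div_nonneg (hc0 i) (hb0 i).le) (hb0 i).le,
          div_mul_cancel₀ _ (hb0 i).ne']
      · refine Finset.prod_congr rfl fun i hi => ?_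
        rw [if_neg (Finset.mem_compl.1 hi)]
    have hPB : 0 ≤ ∏ i, b i ^ (-α) :=
      Finset.prod_nonneg fun i _ => Real.rpow_nonneg (hb0 i).le _
    have h3 : ∑ S ∈ U.powerset, sampleWeight p U S * t ^ f (insert j S) ≤
        (1 + α * ∑ i, (1 - c i / b i)) * ∏ i, b i ^ (-α) := by
      rcases root_le_or_exists_prod_le hs hsr hα ht1 ht (fun i => c i / b i)
        (fun i => div_nonneg (hc0 i) (hb0 i).le) (fun i => (div_le_one (hb0 i)).2 (hcb i))
        with h | ⟨I, hI, hpos, h⟩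
      · exact h1.trans (mul_le_mul_of_nonneg_right h hPB)
      · refine (h2 I hI fun i hi => ?_).trans (mul_le_mul_of_nonneg_right h hPB)
        exact (div_pos_iff_of_pos_right (hb0 i)).1 (hpos i hi)
    rw [sum_sampleWeight_insert hj]
    set a : Fin r → ℝ := fun i => sampleProb p (insert j U) (A i) with ha
    calc (1 - p j) * ∑ S ∈ U.powerset, sampleWeight p U S * t ^ f S +
          p j * ∑ S ∈ U.powerset, sampleWeight p U S * t ^ f (insert j S)
        ≤ (1 - p j) * ∏ i, b i ^ (-α) +
          p j * ((1 + α * ∑ i, (1 - c i / b i)) * ∏ i, b i ^ (-α)) :=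
          add_le_add (mul_le_mul_of_nonneg_left h0 (sub_nonneg.2 hpj.2))
            (mul_le_mul_of_nonneg_left h3 hpj.1)
      _ = (1 + α * ∑ i, p j * (1 - c i / b i)) * ∏ i, b i ^ (-α) := by
          rw [← Finset.mul_sum]
          ring
      _ ≤ (1 + α * ∑ i, (1 - a i / b i)) * ∏ i, b i ^ (-α) := by
          gcongr with i
          have h := div_le_div_of_nonneg_right (hAb i) (hb0 i).le
          rw [add_div, mul_div_cancel_right₀ _ (hb0 i).ne', mul_div_assoc] at h
          change p j * (1 - c i / b i) ≤ 1 - sampleProb p (insert j U) (A i) / b i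
          linarith
      _ ≤ (∏ i, (a i / b i) ^ (-α)) * ∏ i, b i ^ (-α) :=
          mul_le_mul_of_nonneg_right
            (one_add_sum_le_prod_rpow_neg hα0.le _ fun i => div_pos (hA i) (hb0 i)) hPB
      _ = ∏ i, a i ^ (-α) := by
          rw [← Finset.prod_mul_distrib]
          refine Finset.prod_congr rfl fun i _ => ?_
          rw [← Real.mul_rpow (div_nonneg (hA i).le (hb0 i).le) (hb0 i).le,
            div_mul_cancel₀ _ (hb0 i).ne']

end ProductMeasure

section Valuation

variable {m q : ℕ} {v : Finset (Fin m) → ℝ}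

theorem IsLipschitzVal.le_add_card (hLip : IsLipschitzVal m v) (W D : Finset (Fin m)) :
    v (D ∪ W) ≤ v W + D.card := by
  induction D using Finset.induction_on with
  | empty => simp
  | insert j D hj ih =>
    rw [Finset.insert_union, Finset.card_insert_of_notMem hj]
    have := hLip (D ∪ W) j
    push_cast
    linarith

theorem IsQPartitioning.le_of_covered (hv : IsValuation m v) (hQ : IsQPartitioning m q v)
    {s r : ℕ} (hs : 1 ≤ s) (hr : 2 ^ r ≤ q) (W : Finset (Fin m)) (T : Fin r → Finset (Fin m))
    (hW : ∀ j ∈ W, s ≤ (Finset.univ.filter fun i => j ∈ T i).card) :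
    v W ≤ 1 / s * ∑ i, v (T i) := by
  obtain ⟨hv0, hmono, -⟩ := hv
  have hs0 : (0 : ℝ) < s := by exact_mod_cast hs
  obtain ⟨e⟩ : Nonempty (Finset (Fin r) ↪ Fin q) :=
    Function.Embedding.nonempty_of_card_le (by simpa using hr)
  set code : Fin m → Fin q := fun j => e (Finset.univ.filter fun i => j ∈ T i) with hcode
  set P : Fin q → Finset (Fin m) := fun c => W.filter fun j => code j = c with hP
  set D : Fin r → Finset (Fin q) := fun i => Finset.univ.filter fun c => ∃ R, e R = c ∧ i ∈ R
    with hD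
  set E : Finset (Fin q) := Finset.univ.filter fun c =>
    (Finset.univ.filter fun i => c ∈ D i).card < s with hE
  have hcD : ∀ j i, code j ∈ D i ↔ j ∈ T i := fun j i => by
    simp [hD, hcode]
  have hpart : IsPartitionInto m q W P := by
    refine ⟨fun c d hcd => ?_, ?_⟩
    · rw [Finset.disjoint_left]
      intro x hx hx'
      simp only [hP, Finset.mem_filter] at hx hx'
      exact hcd (hx.2.symm.trans hx'.2)
    · ext x
      simp [hP]
  have hcover : IsFractionalCover q
      (fun X => (∑ i, if X = D i then 1 / (s : ℝ) else 0) + if X = E then 1 else 0) := by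
    refine ⟨fun X => ?_, fun c => ?_⟩
    · refine add_nonneg (Finset.sum_nonneg fun i _ => ?_) ?_ <;> split_ifs <;> positivity
    · rw [Finset.sum_add_distrib, Finset.sum_comm]
      simp only [Finset.sum_ite_eq', Finset.mem_filter, Finset.mem_univ, true_and]
      rw [← Finset.sum_filter, Finset.sum_const, nsmul_eq_mul]
      split_ifs with h
      · have : 0 ≤ ((Finset.univ.filter fun i => c ∈ D i).card : ℝ) * (1 / s) := by positivity
        linarith
      · have h' : s ≤ (Finset.univ.filter fun i => c ∈ D i).card := by simpa [hE] using h
        rw [add_zero, mul_one_div, one_le_div hs0]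
        exact_mod_cast h'
  refine (hQ W P hpart _ hcover).trans ?_
  have hsum : ∑ X : Finset (Fin q), ((∑ i, if X = D i then 1 / (s : ℝ) else 0) +
      if X = E then 1 else 0) * v (X.biUnion P) =
      1 / s * ∑ i, v ((D i).biUnion P) + v (E.biUnion P) := by
    simp only [add_mul, Finset.sum_add_distrib, Finset.sum_mul, ite_mul, zero_mul, one_mul]
    rw [Finset.sum_comm]
    simp [Finset.mul_sum]
  have hEP : E.biUnion P = ∅ := by
    rw [Finset.eq_empty_iff_forall_notMem]
    intro x hx
    simp only [Finset.mem_biUnion, hP, Finset.mem_filter] at hx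
    obtain ⟨c, hc, hxW, rfl⟩ := hx
    simp only [hE, Finset.mem_filter, Finset.mem_univ, true_and, hcD] at hc
    exact absurd (hW x hxW) (not_le.2 hc)
  rw [hsum, hEP, hv0, add_zero]
  gcongr with i
  refine hmono _ _ fun x hx => ?_
  simp only [Finset.mem_biUnion, hP, Finset.mem_filter] at hx
  obtain ⟨c, hc, -, rfl⟩ := hx
  exact (hcD x i).1 hc

theorem IsQPartitioning.le_add_card_sparsePart (hv : IsValuation m v)
    (hQ : IsQPartitioning m q v) (hLip : IsLipschitzVal m v) {s r : ℕ} (hs : 1 ≤ s)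
    (hr : 2 ^ r ≤ q) {a : ℝ} (S : Finset (Fin m)) (T : Fin r → Finset (Fin m))
    (hT : ∀ i, v (T i) ≤ a) :
    v S ≤ (r : ℝ) / s * a + (sparsePart s S T).card := by
  set D := sparsePart s S T with hD
  have h1 := hLip.le_add_card (S \ D) D
  have hDS : D ⊆ S := Finset.filter_subset _ _
  rw [Finset.union_sdiff_of_subset hDS] at h1
  have h2 := hQ.le_of_covered hv hs hr (S \ D) T fun j hj => by
    simp only [hD, sparsePart, Finset.mem_sdiff, Finset.mem_filter, not_and, not_lt] at hj
    refine (hj.2 hj.1).trans_eq ?_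
    congr
  have h3 : ∑ i, v (T i) ≤ r * a := by
    have := Finset.sum_le_card_nsmul Finset.univ (fun i => v (T i)) a fun i _ => hT i
    simpa using this
  have h4 : 1 / (s : ℝ) * ∑ i, v (T i) ≤ r / s * a := by
    refine (mul_le_mul_of_nonneg_left h3 (by positivity)).trans_eq ?_
    ring
  linarith

theorem prodWeight_eq_sampleWeight (p : Fin m → ℝ) (S : Finset (Fin m)) :
    prodWeight m p S = sampleWeight p Finset.univ S := by
  rw [prodWeight, sampleWeight, ← Finset.prod_mul_prod_compl S]
  congr 1
  · exact Finset.prod_congr rfl fun j hj => by simp [hj]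
  · exact Finset.prod_congr rfl fun j hj => by simp [Finset.mem_compl.1 hj]

end Valuation

theorem qPartitioning_upperTail_general (m q : ℕ) (hq : 2 ≤ q) (hqm : q ≤ m)
    (v : Finset (Fin m) → ℝ) (hv : IsValuation m v)
    (hQ : IsQPartitioning m q v) (hLip : IsLipschitzVal m v)
    (p : Fin m → ℝ) (hp : ∀ j, 0 ≤ p j ∧ p j ≤ 1)
    (a k : ℝ) (ha : 0 ≤ a) (hk : 0 ≤ k)
    (s r : ℕ) (hs : 1 ≤ s) (hsr : s < r) (hr : 2 ^ r ≤ q)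
    (α : ℝ) (hα : 1 / (s : ℝ) ≤ α)
    (t : ℝ) (ht1 : 1 < t)
    (ht : t + α * r * t ^ (-(1 / (α * s))) = α * r + 1) :
    ENNReal.ofReal (∑ S ∈ Finset.univ.filter
        (fun S : Finset (Fin m) => ((r : ℝ) / s) * a + k ≤ v S), prodWeight m p S) ≤
      ENNReal.ofReal t ^ (-k) *
        ENNReal.ofReal (∑ S ∈ Finset.univ.filter
          (fun S : Finset (Fin m) => v S ≤ a), prodWeight m p S) ^ (-(α * r)) := by
  have hs0 : (0 : ℝ) < s := by exact_mod_cast hs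
  have hα0 : 0 < α := lt_of_lt_of_le (by positivity) hα
  have hr0 : (0 : ℝ) < r := by exact_mod_cast (by omega : 0 < r)
  have ht0 : 0 < t := by linarith
  have hprob : ∑ S ∈ Finset.univ.filter (fun S : Finset (Fin m) => v S ≤ a), prodWeight m p S =
      sampleProb p Finset.univ fun S => v S ≤ a := by
    rw [sampleProb, Finset.powerset_univ, Finset.sum_filter]
    refine Finset.sum_congr rfl fun S _ => ?_
    simp only [prodWeight_eq_sampleWeight]
  rw [hprob]
  set x := sampleProb p Finset.univ fun S => v S ≤ a with hx
  rcases (sampleProb_nonneg hp Finset.univ fun S => v S ≤ a).eq_or_lt with hx0 | hx0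
  · rw [← hx] at hx0
    have htk : ENNReal.ofReal t ^ (-k) ≠ 0 := by
      rw [ENNReal.ofReal_rpow_of_pos ht0]
      simpa using Real.rpow_pos_of_pos ht0 (-k)
    rw [← hx0, ENNReal.ofReal_zero, ENNReal.zero_rpow_of_neg (by simp; positivity),
      ENNReal.mul_top htk]
    exact le_top
  · rw [← hx] at hx0
    rw [ENNReal.ofReal_rpow_of_pos ht0, ENNReal.ofReal_rpow_of_pos hx0,
      ← ENNReal.ofReal_mul (by positivity)]
    refine ENNReal.ofReal_le_ofReal ?_
    have h := sum_sampleWeight_mul_rpow_le hs hsr hα ht1 ht hp Finset.univ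
      (fun _ S => v S ≤ a) (fun S => if (r : ℝ) / s * a + k ≤ v S then k else 0)
      (fun _ => hx0) fun S _ T _ hT => by
        have h := hQ.le_add_card_sparsePart hv hLip hs hr S T hT
        split_ifs
        · linarith
        · positivity
    rw [← hx, Finset.prod_const, Finset.card_univ, Fintype.card_fin, ← Real.rpow_mul_natCast hx0.le,
      Finset.powerset_univ, neg_mul] at h
    rw [Real.rpow_neg ht0.le, inv_mul_eq_div, le_div_iff₀ (by positivity), Finset.sum_mul]
    refine le_trans ?_ h
    rw [Finset.sum_filter]
    refine Finset.sum_le_sum fun S _ => ?_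
    have := sampleWeight_nonneg hp Finset.univ S
    split_ifs
    · rw [prodWeight_eq_sampleWeight]
    · positivity
end

section
/- Let 0 < β ≤ 1 and let v be a normalized monotone valuation over [m] with all marginal values in [0,1] that is β-close to being XOS. Let S ⊆ [m] be a random set in which each element appears independently. Then for any real numbers ψ ≥ 1+δ > 1, a > 0, and k ≥ 0: P[ v(S) ≥ ((1+δ)/β)·a + k ] ≤ ξ(ψ,δ)^{−k} · P[v(S) ≤ a]^{−ψ}, where ξ(ψ,δ) denotes the larger root of the equation ξ + ψ·ξ^{−(1+δ)/ψ} = ψ + 1. In particular, taking a a median of v(S) and ψ = 1+δ (so ξ = 1+δ): P[ v(S) ≥ ((1+δ)/β)·a + k ] ≤ (1+δ)^{−k}·2^{1+δ}. -/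
open Finset
open scoped Classical ENNReal

/-- `v` is `β`-close to being XOS: for every `S` and every fractional cover of `S`,
the fractional covering value is at least `β * v S`. -/
def IsBetaCloseXOS (m : ℕ) (β : ℝ) (v : Finset (Fin m) → ℝ) : Prop :=
  ∀ S : Finset (Fin m), ∀ α : Finset (Fin m) → ℝ, (∀ T, 0 ≤ α T) →
    (∀ j ∈ S, 1 ≤ ∑ T ∈ Finset.univ.filter (fun T : Finset (Fin m) => j ∈ T), α T) →
    β * v S ≤ ∑ T : Finset (Fin m), α T * v (T ∩ S)

/-- Expectation of `f` over a random subset of `J` containing each `j ∈ J` independently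
with probability `p j`. -/
noncomputable def subsetExp {α : Type*} [DecidableEq α] (p : α → ℝ) (J : Finset α)
    (f : Finset α → ℝ) : ℝ :=
  ∑ S ∈ J.powerset, ((∏ j ∈ S, p j) * ∏ j ∈ J \ S, (1 - p j)) * f S

/-- Probability that a random subset of `J` lies in `A`. -/
noncomputable def subsetProb {α : Type*} [DecidableEq α] (p : α → ℝ) (J : Finset α)
    (A : Set (Finset α)) : ℝ :=
  subsetExp p J (A.indicator 1)

/-- The elements of `S` that belong to fewer than `r` of the sets `y i`. -/
def undercovered {α ι : Type*} [DecidableEq α] [Fintype ι] (r : ℕ) (y : ι → Finset α)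
    (S : Finset α) : Finset α :=
  S.filter fun j => (Finset.univ.filter fun i => j ∈ y i).card < r

/-- The least number of elements of `S` covered fewer than `r` times by a choice of one set
from each `A i`. -/
noncomputable def coverDist {α ι : Type*} [DecidableEq α] [Fintype ι] (r : ℕ)
    (A : ι → Set (Finset α)) (S : Finset α) : ℕ :=
  sInf {k | ∃ y : ι → Finset α, (∀ i, y i ∈ A i) ∧ (undercovered r y S).card = k}

section SubsetExp

variable {α : Type*} [DecidableEq α] {p : α → ℝ} {J : Finset α}

lemma subsetExp_insert {j : α} (hj : j ∉ J) (f : Finset α → ℝ) :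
    subsetExp p (insert j J) f =
      (1 - p j) * subsetExp p J f + p j * subsetExp p J fun S => f (insert j S) := by
  unfold subsetExp
  rw [Finset.sum_powerset_insert hj, Finset.mul_sum, Finset.mul_sum]
  congr 1 <;> refine Finset.sum_congr rfl fun S hS => ?_
  · have hjS : j ∉ S := fun h => hj (Finset.mem_powerset.1 hS h)
    rw [Finset.insert_sdiff_of_notMem _ hjS, Finset.prod_insert (by simp [hj])]
    ring
  · have hjS : j ∉ S := fun h => hj (Finset.mem_powerset.1 hS h)
    have : insert j J \ insert j S = J \ S := by
      ext x
      simp only [Finset.mem_sdiff, Finset.mem_insert]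
      constructor
      · tauto
      · rintro ⟨h1, h2⟩
        have : x ≠ j := fun h => hj (h ▸ h1)
        tauto
    rw [this, Finset.prod_insert hjS]
    ring

lemma subsetExp_mono (hp : ∀ j, 0 ≤ p j ∧ p j ≤ 1) {f g : Finset α → ℝ} (h : ∀ S, f S ≤ g S) :
    subsetExp p J f ≤ subsetExp p J g := by
  refine Finset.sum_le_sum fun S _ => mul_le_mul_of_nonneg_left (h S) ?_
  exact mul_nonneg (Finset.prod_nonneg fun j _ => (hp j).1)
    (Finset.prod_nonneg fun j _ => by linarith [(hp j).2])

lemma subsetExp_const_mul (c : ℝ) (f : Finset α → ℝ) :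
    subsetExp p J (fun S => c * f S) = c * subsetExp p J f := by
  unfold subsetExp
  rw [Finset.mul_sum]
  exact Finset.sum_congr rfl fun S _ => by ring

lemma subsetExp_nonneg (hp : ∀ j, 0 ≤ p j ∧ p j ≤ 1) {f : Finset α → ℝ} (h : ∀ S, 0 ≤ f S) :
    0 ≤ subsetExp p J f := by
  have := subsetExp_mono (J := J) hp (f := fun S => 0 * f S) (g := f) (by simpa using h)
  rw [subsetExp_const_mul] at this
  simpa using this

lemma subsetProb_nonneg (hp : ∀ j, 0 ≤ p j ∧ p j ≤ 1) (A : Set (Finset α)) :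
    0 ≤ subsetProb p J A :=
  subsetExp_nonneg hp fun S => Set.indicator_nonneg (by simp) S

lemma subsetProb_mono (hp : ∀ j, 0 ≤ p j ∧ p j ≤ 1) {A B : Set (Finset α)} (h : A ⊆ B) :
    subsetProb p J A ≤ subsetProb p J B :=
  subsetExp_mono hp fun S => Set.indicator_le_indicator_of_subset h (by simp) S

lemma subsetProb_insert {j : α} (hj : j ∉ J) (A : Set (Finset α)) :
    subsetProb p (insert j J) A =
      (1 - p j) * subsetProb p J A + p j * subsetProb p J {S | insert j S ∈ A} := by
  unfold subsetProb
  rw [subsetExp_insert hj]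
  rfl

lemma nonempty_of_subsetProb_ne_zero {A : Set (Finset α)} (h : subsetProb p J A ≠ 0) :
    A.Nonempty := by
  by_contra hA
  rw [Set.not_nonempty_iff_eq_empty] at hA
  simp [hA, subsetProb, subsetExp] at h

end SubsetExp

section CoverDist

variable {α ι : Type*} [DecidableEq α] [Fintype ι] {r : ℕ} {A : ι → Set (Finset α)}

lemma coverDist_le {y : ι → Finset α} (hy : ∀ i, y i ∈ A i) (S : Finset α) :
    coverDist r A S ≤ (undercovered r y S).card :=
  Nat.sInf_le ⟨y, hy, rfl⟩

lemma exists_card_eq_coverDist (hA : ∀ i, (A i).Nonempty) (S : Finset α) :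
    ∃ y : ι → Finset α, (∀ i, y i ∈ A i) ∧ (undercovered r y S).card = coverDist r A S := by
  choose y hy using hA
  exact Nat.sInf_mem (s := {k | ∃ y : ι → Finset α, (∀ i, y i ∈ A i) ∧
    (undercovered r y S).card = k}) ⟨_, y, hy, rfl⟩

lemma coverDist_empty : coverDist r A ∅ = 0 := by
  by_cases h : ∃ y : ι → Finset α, ∀ i, y i ∈ A i
  · obtain ⟨y, hy⟩ := h
    simpa [undercovered] using coverDist_le (r := r) hy ∅
  · unfold coverDist
    rw [Nat.sInf_eq_zero]
    right
    ext k
    simp only [Set.mem_ofPred_eq, Set.mem_empty_iff_false, iff_false]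
    rintro ⟨y, hy, -⟩
    exact h ⟨y, hy⟩

lemma coverDist_insert_le (hA : ∀ i, (A i).Nonempty) (j : α) (S : Finset α) :
    coverDist r A (insert j S) ≤ coverDist r A S + 1 := by
  obtain ⟨y, hy, h⟩ := exists_card_eq_coverDist (r := r) hA S
  rw [← h]
  refine (coverDist_le hy _).trans ((Finset.card_le_card ?_).trans (Finset.card_insert_le j _))
  intro x
  simp only [undercovered, Finset.mem_filter, Finset.mem_insert]
  tauto

lemma coverDist_insert_le_of_card (I : Finset ι) (hI : r ≤ I.card) (j : α)
    (hA : ∀ i, (if i ∈ I then {T | insert j T ∈ A i} else A i).Nonempty) (S : Finset α) :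
    coverDist r A (insert j S) ≤
      coverDist r (fun i => if i ∈ I then {T | insert j T ∈ A i} else A i) S := by
  obtain ⟨y, hy, h⟩ := exists_card_eq_coverDist (r := r) hA S
  rw [← h]
  have hz : ∀ i, (if i ∈ I then insert j (y i) else y i) ∈ A i := by
    intro i
    have := hy i
    split_ifs with hi
    · simpa [hi] using this
    · simpa [hi] using this
  refine (coverDist_le hz _).trans (Finset.card_le_card ?_)
  intro x
  simp only [undercovered, Finset.mem_filter, Finset.mem_insert]
  rintro ⟨hx, hcard⟩
  have hxj : x ≠ j := by
    rintro rfl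
    refine absurd (hI.trans (Finset.card_le_card ?_)) (not_le.2 hcard)
    intro i hi
    simp [hi]
  refine ⟨by tauto, lt_of_le_of_lt (Finset.card_le_card ?_) hcard⟩
  intro i
  simp only [Finset.mem_filter, Finset.mem_univ, true_and]
  intro hi
  split_ifs <;> simp [hi]

end CoverDist

section Analytic

lemma exp_mul_sub_one_le {θ : ℝ} (h0 : 0 ≤ θ) (h1 : θ ≤ 1) (x : ℝ) :
    Real.exp (θ * x) - 1 ≤ θ * (Real.exp x - 1) := by
  have := convexOn_exp.2 (Set.mem_univ 0) (Set.mem_univ x) (sub_nonneg.2 h1) h0 (by ring)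
  simp only [smul_eq_mul, mul_zero, zero_add, Real.exp_zero] at this
  linarith

lemma exp_mul_sub_one_lt {θ x : ℝ} (h0 : 0 < θ) (h1 : θ < 1) (hx : x ≠ 0) :
    Real.exp (θ * x) - 1 < θ * (Real.exp x - 1) := by
  have := strictConvexOn_exp.2 (Set.mem_univ 0) (Set.mem_univ x) hx.symm (sub_pos.2 h1) h0
    (by ring)
  simp only [smul_eq_mul, mul_zero, zero_add, Real.exp_zero] at this
  linarith

lemma exp_mul_sub_one_le_two_level {ψ s q τ ρ : ℝ} (hψ : 0 < ψ) (hs : 0 < s) (hs1 : s ≤ 1)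
    (hq : 0 < q) (h1 : Real.exp (ψ * s * q) - 1 ≤ ψ * (1 - Real.exp (-q)))
    (h2 : s ≤ Real.exp (-q)) (hτ : 0 < τ) (hρ0 : 0 ≤ ρ) (hρτ : ρ ≤ τ) (hρq : ρ ≤ q) :
    Real.exp (ψ * s * ρ) - 1 ≤ ψ * ((1 - Real.exp (-τ)) * (s * (ρ / τ) + (1 - s))) := by
  have hθ0 : 0 ≤ ρ / q := by positivity
  have hθ1 : ρ / q ≤ 1 := (div_le_one hq).2 hρq
  have hη0 : 0 ≤ ρ / τ := by positivity
  have hη1 : ρ / τ ≤ 1 := (div_le_one hτ).2 hρτ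
  have hτ1 : 0 ≤ 1 - Real.exp (-τ) := by
    have : Real.exp (-τ) ≤ 1 := Real.exp_le_one_iff.2 (by linarith)
    linarith
  have hstep : Real.exp (ψ * s * ρ) - 1 ≤ ψ * (ρ / q * (1 - Real.exp (-q))) := by
    have := exp_mul_sub_one_le hθ0 hθ1 (ψ * s * q)
    have e : ρ / q * (ψ * s * q) = ψ * s * ρ := by field_simp
    rw [e] at this
    have := mul_le_mul_of_nonneg_left h1 hθ0
    linarith
  refine hstep.trans (mul_le_mul_of_nonneg_left ?_ hψ.le)
  rcases le_total τ q with h | h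
  · have hc := exp_mul_sub_one_le (θ := τ / q) (by positivity) ((div_le_one hq).2 h) (-q)
    have e : τ / q * -q = -τ := by field_simp
    rw [e] at hc
    have h3 : ρ / q * (1 - Real.exp (-q)) ≤ (1 - Real.exp (-τ)) * (ρ / τ) := by
      have e2 : ρ / q = ρ / τ * (τ / q) := by field_simp
      have := mul_le_mul_of_nonneg_left hc hη0
      rw [e2]
      linarith
    refine h3.trans (mul_le_mul_of_nonneg_left ?_ hτ1)
    nlinarith
  · have hc := exp_mul_sub_one_le (θ := q / τ) (by positivity) ((div_le_one hτ).2 h) τ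
    have e : q / τ * τ = q := by field_simp
    rw [e] at hc
    set u := q / τ
    have hu0 : 0 ≤ u := by positivity
    have hu1 : u ≤ 1 := (div_le_one hτ).2 h
    have hgG : Real.exp (-q) * Real.exp q = 1 := by rw [← Real.exp_add]; simp
    have htT : Real.exp (-τ) * Real.exp τ = 1 := by rw [← Real.exp_add]; simp
    set g := Real.exp (-q)
    set G := Real.exp q
    set t := Real.exp (-τ)
    set T := Real.exp τ
    have hg : 0 < g := Real.exp_pos _
    have ht : 0 < t := Real.exp_pos _
    have e1 : t * (1 - g) ≤ g * u * (1 - t) := by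
      have := mul_le_mul_of_nonneg_left hc (mul_pos hg ht).le
      have l : g * t * (G - 1) = t * (1 - g) := by linear_combination t * hgG
      have rr : g * t * (u * (T - 1)) = g * u * (1 - t) := by linear_combination g * u * htT
      linarith
    have e2 : 1 - g ≤ (1 - t) * (s * u + (1 - s)) := by
      have : (1 - t) * (g * u + (1 - g)) ≤ (1 - t) * (s * u + (1 - s)) :=
        mul_le_mul_of_nonneg_left (by nlinarith) hτ1
      nlinarith
    have e3 : ρ / τ = ρ / q * u := by simp only [u]; field_simp
    rw [e3]
    set θ := ρ / q
    calc θ * (1 - g) ≤ θ * ((1 - t) * (s * u + (1 - s))) := mul_le_mul_of_nonneg_left e2 hθ0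
      _ = (1 - t) * (s * (θ * u) + θ * (1 - s)) := by ring
      _ ≤ _ := by
        refine mul_le_mul_of_nonneg_left ?_ hτ1
        nlinarith

end Analytic

lemma exists_card_eq_forall_le_s13 {ι : Type*} [Fintype ι] (x : ι → ℝ) {r : ℕ}
    (hr : r ≤ Fintype.card ι) :
    ∃ I : Finset ι, I.card = r ∧ ∀ i ∈ I, ∀ k ∉ I, x k ≤ x i := by
  have hne : (Finset.powersetCard r (Finset.univ : Finset ι)).Nonempty :=
    Finset.powersetCard_nonempty.2 hr
  obtain ⟨I, hI, hmax⟩ := Finset.exists_max_image _ (fun I => ∑ i ∈ I, x i) hne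
  rw [Finset.mem_powersetCard_univ] at hI
  refine ⟨I, hI, fun i hi k hk => ?_⟩
  have hk' : k ∉ I.erase i := fun h => hk (Finset.mem_of_mem_erase h)
  have h := hmax (insert k (I.erase i)) (by
    rw [Finset.mem_powersetCard_univ, Finset.card_insert_of_notMem hk',
      Finset.card_erase_add_one hi, hI])
  rw [Finset.sum_insert hk', ← Finset.add_sum_erase I x hi] at h
  linarith

/-- Either all of `ξ = exp (ψ s q)` is paid for by the deficits `1 - x i`, or there are `r`
indices of large `x` whose inverse product is. -/
lemma deficit_dichotomy {ι : Type*} [Fintype ι] {ψ s q : ℝ} {r : ℕ} (hψ : 0 < ψ)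
    (hr0 : 0 < r) (hr : r ≤ Fintype.card ι) (hs : s = r / Fintype.card ι)
    (hq : 0 < q) (h1 : Real.exp (ψ * s * q) - 1 ≤ ψ * (1 - Real.exp (-q)))
    (h2 : s ≤ Real.exp (-q)) (x : ι → ℝ) (hx0 : ∀ i, 0 ≤ x i) (hx1 : ∀ i, x i ≤ 1) :
    Real.exp (ψ * s * q) - 1 ≤ ψ / Fintype.card ι * ∑ i, (1 - x i) ∨
    ∃ I : Finset ι, r ≤ I.card ∧ (∀ i ∈ I, 0 < x i) ∧
      (∏ i ∈ I, x i ^ (-(ψ / Fintype.card ι))) - 1 ≤ ψ / Fintype.card ι * ∑ i, (1 - x i) := by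
  obtain ⟨I, hI, htop⟩ := exists_card_eq_forall_le_s13 x hr
  set N : ℝ := ((Fintype.card ι : ℕ) : ℝ) with hN
  have hNpos : 0 < N := by rw [hN]; exact_mod_cast hr0.trans_le hr
  have hspos : 0 < s := by rw [hs]; positivity
  have hs1 : s ≤ 1 := by
    rw [hs, div_le_one hNpos, hN]; exact_mod_cast hr
  have hsN : (r : ℝ) = s * N := by rw [hs]; field_simp
  have hsumnn : 0 ≤ ψ / N * ∑ i, (1 - x i) :=
    mul_nonneg (by positivity) (Finset.sum_nonneg fun i _ => by linarith [hx1 i])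
  obtain ⟨i₀, hi₀, hmin⟩ := Finset.exists_min_image I x (Finset.card_pos.1 (hI ▸ hr0))
  have hsplit : ∑ i, (1 - x i) = ∑ i ∈ I, (1 - x i) + ∑ i ∈ Iᶜ, (1 - x i) :=
    (Finset.sum_add_sum_compl I _).symm
  have hcompl : (N - r) * (1 - x i₀) ≤ ∑ i ∈ Iᶜ, (1 - x i) := by
    have : (Iᶜ.card : ℝ) = N - r := by
      rw [Finset.card_compl, Nat.cast_sub (hI ▸ hr), hI]
    rw [← this, ← nsmul_eq_mul]
    refine Finset.card_nsmul_le_sum _ _ _ fun i hi => ?_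
    have := htop i₀ hi₀ i (Finset.mem_compl.1 hi)
    linarith
  have hInn : 0 ≤ ∑ i ∈ I, (1 - x i) := Finset.sum_nonneg fun i _ => by linarith [hx1 i]
  rcases (hx0 i₀).eq_or_lt with hz | hpos
  · left
    rw [← hz] at hcompl
    have : N - r ≤ ∑ i, (1 - x i) := by linarith
    calc Real.exp (ψ * s * q) - 1 ≤ ψ * (1 - s) := by nlinarith
      _ = ψ / N * (N - r) := by rw [hsN]; field_simp
      _ ≤ _ := mul_le_mul_of_nonneg_left this (by positivity)
  have hIpos : ∀ i ∈ I, 0 < x i := fun i hi => hpos.trans_le (hmin i hi)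
  have hprod : ∏ i ∈ I, x i ^ (-(ψ / N)) = Real.exp (ψ / N * ∑ i ∈ I, -Real.log (x i)) := by
    rw [Finset.mul_sum, Real.exp_sum]
    refine Finset.prod_congr rfl fun i hi => ?_
    rw [Real.rpow_def_of_pos (hIpos i hi)]
    congr 1
    ring
  rcases (hx1 i₀).eq_or_lt with hone | hlt
  · right
    refine ⟨I, hI.ge, hIpos, ?_⟩
    have : ∑ i ∈ I, -Real.log (x i) = 0 := Finset.sum_eq_zero fun i hi => by
      have : x i = 1 := le_antisymm (hx1 i) (hone ▸ hmin i hi)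
      simp [this]
    rw [hprod, this]
    simpa using hsumnn
  set τ := -Real.log (x i₀) with hτdef
  have hτ : 0 < τ := by
    have := Real.log_neg hpos hlt
    linarith
  have hexpτ : Real.exp (-τ) = x i₀ := by rw [hτdef, neg_neg, Real.exp_log hpos]
  have hlog0 : ∀ i ∈ I, 0 ≤ -Real.log (x i) := fun i hi => by
    have := Real.log_nonpos (hx0 i) (hx1 i)
    linarith
  have hlogτ : ∀ i ∈ I, -Real.log (x i) ≤ τ := fun i hi => by
    have := Real.log_le_log hpos (hmin i hi)
    linarith
  set σ := ∑ i ∈ I, -Real.log (x i) with hσdef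
  have hσ0 : 0 ≤ σ := Finset.sum_nonneg hlog0
  have hστ : σ ≤ r * τ := by
    have := Finset.sum_le_card_nsmul I _ _ hlogτ
    rwa [nsmul_eq_mul, hI] at this
  have hr' : (0 : ℝ) < r := by exact_mod_cast hr0
  set ρ := σ / r with hρdef
  have hσρ : σ = r * ρ := by rw [hρdef]; field_simp
  have hρ0 : 0 ≤ ρ := by positivity
  have hρτ : ρ ≤ τ := by rw [hρdef, div_le_iff₀ hr']; linarith
  have hexpσ : ψ / N * σ = ψ * s * ρ := by rw [hσρ, hsN]; field_simp
  have hIsum : σ / τ * (1 - Real.exp (-τ)) ≤ ∑ i ∈ I, (1 - x i) := by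
    rw [hσdef, Finset.sum_div, Finset.sum_mul]
    refine Finset.sum_le_sum fun i hi => ?_
    have := exp_mul_sub_one_le (div_nonneg (hlog0 i hi) hτ.le) ((div_le_one hτ).2 (hlogτ i hi)) (-τ)
    have e : -Real.log (x i) / τ * -τ = Real.log (x i) := by field_simp
    rw [e, Real.exp_log (hIpos i hi)] at this
    linarith
  have hK : ψ * ((1 - Real.exp (-τ)) * (s * (ρ / τ) + (1 - s))) ≤
      ψ / N * ∑ i, (1 - x i) := by
    have h3 : σ / τ * (1 - Real.exp (-τ)) + (N - r) * (1 - Real.exp (-τ)) ≤ ∑ i, (1 - x i) := by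
      rw [hexpτ] at hIsum ⊢
      linarith
    refine le_trans (le_of_eq ?_) (mul_le_mul_of_nonneg_left h3 (by positivity : 0 ≤ ψ / N))
    rw [hσρ, hsN]
    field_simp
  rcases le_total ρ q with hρq | hqρ
  · right
    refine ⟨I, hI.ge, hIpos, ?_⟩
    rw [hprod, hexpσ]
    exact (exp_mul_sub_one_le_two_level hψ hspos hs1 hq h1 h2 hτ hρ0 hρτ hρq).trans hK
  · left
    refine (exp_mul_sub_one_le_two_level hψ hspos hs1 hq h1 h2 hτ hq.le
      (hqρ.trans hρτ) le_rfl).trans (le_trans ?_ hK)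
    have : 0 ≤ 1 - Real.exp (-τ) := by rw [hexpτ]; linarith
    gcongr

lemma one_add_mul_sum_le_prod_rpow {ι : Type*} [Fintype ι] {κ : ℝ} (hκ : 0 ≤ κ) {u : ι → ℝ}
    (hu : ∀ i, 0 < u i) : 1 + κ * ∑ i, (1 - u i) ≤ ∏ i, u i ^ (-κ) := by
  have : ∏ i, u i ^ (-κ) = Real.exp (κ * ∑ i, -Real.log (u i)) := by
    rw [Finset.mul_sum, Real.exp_sum]
    refine Finset.prod_congr rfl fun i _ => ?_
    rw [Real.rpow_def_of_pos (hu i)]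
    congr 1
    ring
  rw [this]
  have h1 := Real.add_one_le_exp (κ * ∑ i, -Real.log (u i))
  have h2 : κ * ∑ i, (1 - u i) ≤ κ * ∑ i, -Real.log (u i) := by
    refine mul_le_mul_of_nonneg_left (Finset.sum_le_sum fun i _ => ?_) hκ
    have := Real.log_le_sub_one_of_pos (hu i)
    linarith
  linarith

theorem subsetExp_exp_coverDist_mul_prod_le_one {α ι : Type*} [DecidableEq α] [Fintype ι]
    {p : α → ℝ} (hp : ∀ j, 0 ≤ p j ∧ p j ≤ 1) {ψ s q : ℝ} {r : ℕ} (hψ : 0 < ψ)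
    (hr0 : 0 < r) (hr : r ≤ Fintype.card ι) (hs : s = r / Fintype.card ι)
    (hq : 0 < q) (h1 : Real.exp (ψ * s * q) - 1 ≤ ψ * (1 - Real.exp (-q)))
    (h2 : s ≤ Real.exp (-q)) (J : Finset α) (A : ι → Set (Finset α))
    (hA : ∀ i, IsLowerSet (A i)) :
    subsetExp p J (fun S => Real.exp (ψ * s * q * coverDist r A S)) *
      ∏ i, subsetProb p J (A i) ^ (ψ / Fintype.card ι) ≤ 1 := by
  have hNpos : (0 : ℝ) < Fintype.card ι := by exact_mod_cast hr0.trans_le hr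
  have hspos : 0 < s := by
    rw [hs]
    have : (0 : ℝ) < r := by exact_mod_cast hr0
    positivity
  have hL : 0 ≤ ψ * s * q := by positivity
  have hκ : 0 < ψ / Fintype.card ι := by positivity
  induction J using Finset.induction_on generalizing A with
  | empty =>
    have hE : subsetExp p ∅ (fun S => Real.exp (ψ * s * q * coverDist r A S)) = 1 := by
      simp [subsetExp, coverDist_empty]
    rw [hE, one_mul]
    refine Finset.prod_le_one (fun i _ => Real.rpow_nonneg (subsetProb_nonneg hp _) _)
      fun i _ => Real.rpow_le_one (subsetProb_nonneg hp _) ?_ hκ.le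
    simp only [subsetProb, subsetExp, Finset.powerset_empty, Finset.sum_singleton]
    simp [Set.indicator_apply]
    split_ifs <;> norm_num
  | insert j J hj ih =>
    by_cases hz : ∃ i, subsetProb p (insert j J) (A i) = 0
    · obtain ⟨i, hi⟩ := hz
      rw [Finset.prod_eq_zero (Finset.mem_univ i) (by rw [hi, Real.zero_rpow hκ.ne'])]
      simp
    push Not at hz
    set κ := ψ / Fintype.card ι with hκdef
    set ℓ := ψ * s * q
    set A₁ : ι → Set (Finset α) := fun i => {T | insert j T ∈ A i} with hA₁
    have hA₁low : ∀ i, IsLowerSet (A₁ i) := fun i S T hTS hS =>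
      hA i (Finset.insert_subset_insert j hTS) hS
    have hA₁sub : ∀ i, A₁ i ⊆ A i := fun i S hS => hA i (Finset.subset_insert j S) hS
    set b : ι → ℝ := fun i => subsetProb p J (A i) with hb
    set a : ι → ℝ := fun i => subsetProb p J (A₁ i) with ha
    have hab : ∀ i, a i ≤ b i := fun i => subsetProb_mono hp (hA₁sub i)
    have ha0 : ∀ i, 0 ≤ a i := fun i => subsetProb_nonneg hp _
    have hPins : ∀ i, subsetProb p (insert j J) (A i) = (1 - p j) * b i + p j * a i :=
      fun i => subsetProb_insert hj _
    have hPpos : ∀ i, 0 < (1 - p j) * b i + p j * a i := fun i => by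
      rw [← hPins]
      exact (subsetProb_nonneg hp _).lt_of_ne (hz i).symm
    have hbpos : ∀ i, 0 < b i := fun i => by
      have := hPpos i
      have := mul_le_mul_of_nonneg_left (hab i) (hp j).1
      nlinarith
    have hAne : ∀ i, (A i).Nonempty := fun i => nonempty_of_subsetProb_ne_zero (hbpos i).ne'
    set x : ι → ℝ := fun i => a i / b i with hx
    have hx0 : ∀ i, 0 ≤ x i := fun i => div_nonneg (ha0 i) (hbpos i).le
    have hx1 : ∀ i, x i ≤ 1 := fun i => (div_le_one (hbpos i)).2 (hab i)
    have hbx : ∀ i, a i = b i * x i := fun i => by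
      have := (hbpos i).ne'
      simp only [hx]
      field_simp
    set u : ι → ℝ := fun i => 1 - p j * (1 - x i) with hu
    have hPu : ∀ i, (1 - p j) * b i + p j * a i = b i * u i := fun i => by
      rw [hbx]
      simp only [hu]
      ring
    have hupos : ∀ i, 0 < u i := fun i => by
      have := hPpos i
      rw [hPu] at this
      exact pos_of_mul_pos_right this (hbpos i).le
    set D := ∏ i, b i ^ κ with hD
    have hDpos : 0 < D := Finset.prod_pos fun i _ => Real.rpow_pos_of_pos (hbpos i) _
    have hL0 := ih A hA
    set E₀ := subsetExp p J fun S => Real.exp (ℓ * coverDist r A S) with hE₀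
    set E₁ := subsetExp p J fun S => Real.exp (ℓ * coverDist r A (insert j S)) with hE₁
    have hkey : E₁ * D ≤ 1 + κ * ∑ i, (1 - x i) := by
      rcases deficit_dichotomy hψ hr0 hr hs hq h1 h2 x hx0 hx1 with h | ⟨I, hIr, hIpos, hI⟩
      · have hle : E₁ ≤ Real.exp ℓ * E₀ := by
          rw [hE₀, ← subsetExp_const_mul]
          refine subsetExp_mono hp fun S => ?_
          rw [← Real.exp_add]
          have : (coverDist r A (insert j S) : ℝ) ≤ coverDist r A S + 1 := by
            exact_mod_cast coverDist_insert_le hAne j S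
          refine Real.exp_le_exp.2 ?_
          nlinarith
        have := mul_le_mul_of_nonneg_right hle hDpos.le
        have := mul_le_mul_of_nonneg_left hL0 (Real.exp_pos ℓ).le
        linarith
      · set B : ι → Set (Finset α) := fun i => if i ∈ I then A₁ i else A i with hB
        have hBlow : ∀ i, IsLowerSet (B i) := fun i => by
          simp only [hB]
          split_ifs
          · exact hA₁low i
          · exact hA i
        have hBP : ∀ i, subsetProb p J (B i) = b i * if i ∈ I then x i else 1 := fun i => by
          simp only [hB]
          split_ifs
          · exact hbx i
          · simp [hb]
        have hBne : ∀ i, (B i).Nonempty := fun i => by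
          refine nonempty_of_subsetProb_ne_zero (p := p) (J := J) ?_
          rw [hBP]
          refine mul_ne_zero (hbpos i).ne' ?_
          split_ifs with hi
          · exact (hIpos i hi).ne'
          · exact one_ne_zero
        have hle : E₁ ≤ subsetExp p J fun S => Real.exp (ℓ * coverDist r B S) := by
          refine subsetExp_mono hp fun S => Real.exp_le_exp.2 (mul_le_mul_of_nonneg_left ?_ hL)
          exact_mod_cast coverDist_insert_le_of_card I hIr j hBne S
        have hprod : ∏ i, subsetProb p J (B i) ^ κ = D * ∏ i ∈ I, x i ^ κ := by
          rw [hD, ← Finset.prod_ite_mem_eq I, ← Finset.prod_mul_distrib]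
          refine Finset.prod_congr rfl fun i _ => ?_
          rw [hBP, Real.mul_rpow (hbpos i).le]
          · split_ifs <;> simp
          · split_ifs
            · exact hx0 i
            · exact zero_le_one
        have hih := ih B hBlow
        rw [hprod] at hih
        have hXpos : 0 < ∏ i ∈ I, x i ^ κ :=
          Finset.prod_pos fun i hi => Real.rpow_pos_of_pos (hIpos i hi) _
        have hinv : ∏ i ∈ I, x i ^ (-κ) = (∏ i ∈ I, x i ^ κ)⁻¹ := by
          rw [← Finset.prod_inv_distrib]
          exact Finset.prod_congr rfl fun i hi => Real.rpow_neg (hx0 i) _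
        have h3 : E₁ * D ≤ ∏ i ∈ I, x i ^ (-κ) := by
          rw [hinv, ← one_div, le_div_iff₀ hXpos, mul_assoc]
          exact (mul_le_mul_of_nonneg_right hle (by positivity)).trans hih
        linarith
    have hprodP : ∏ i, subsetProb p (insert j J) (A i) ^ κ = D * ∏ i, u i ^ κ := by
      rw [hD, ← Finset.prod_mul_distrib]
      refine Finset.prod_congr rfl fun i _ => ?_
      rw [hPins, hPu, Real.mul_rpow (hbpos i).le (hupos i).le]
    have hUpos : 0 < ∏ i, u i ^ κ := Finset.prod_pos fun i _ => Real.rpow_pos_of_pos (hupos i) _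
    have hUinv : ∏ i, u i ^ (-κ) = (∏ i, u i ^ κ)⁻¹ := by
      rw [← Finset.prod_inv_distrib]
      exact Finset.prod_congr rfl fun i _ => Real.rpow_neg (hupos i).le _
    have hjensen := one_add_mul_sum_le_prod_rpow hκ.le hupos
    rw [hUinv] at hjensen
    have hsum : ∑ i, (1 - u i) = p j * ∑ i, (1 - x i) := by
      rw [Finset.mul_sum]
      exact Finset.sum_congr rfl fun i _ => by simp only [hu]; ring
    rw [subsetExp_insert hj, hprodP, ← mul_assoc, ← le_div_iff₀ hUpos, one_div]
    refine le_trans ?_ hjensen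
    rw [hsum]
    have e1 := mul_le_mul_of_nonneg_left hL0 (sub_nonneg.2 (hp j).2)
    have e2 := mul_le_mul_of_nonneg_left hkey (hp j).1
    calc ((1 - p j) * E₀ + p j * E₁) * D = (1 - p j) * (E₀ * D) + p j * (E₁ * D) := by ring
      _ ≤ (1 - p j) * 1 + p j * (1 + κ * ∑ i, (1 - x i)) := add_le_add e1 e2
      _ = _ := by ring

lemma le_add_card_of_marginal_le_one {α : Type*} [DecidableEq α] {v : Finset α → ℝ}
    (hmarg : ∀ (S : Finset α) (i : α), v (insert i S) - v S ≤ 1) (S U : Finset α) :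
    v (S ∪ U) ≤ v S + U.card := by
  induction U using Finset.induction_on with
  | empty => simp
  | insert i U hi ih =>
    rw [Finset.union_insert, Finset.card_insert_of_notMem hi]
    have := hmarg (S ∪ U) i
    push_cast
    linarith

lemma IsBetaCloseXOS.le_add_card_undercovered {m : ℕ} {β : ℝ} {v : Finset (Fin m) → ℝ}
    (hclose : IsBetaCloseXOS m β v) (hβ : 0 < β) (hv : IsValuation m v)
    (hmarg : ∀ (S : Finset (Fin m)) (i : Fin m), v (insert i S) - v S ≤ 1)
    {ι : Type*} [Fintype ι] {r : ℕ} (hr : 0 < r) {a : ℝ} {y : ι → Finset (Fin m)}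
    (hy : ∀ i, v (y i) ≤ a) (S : Finset (Fin m)) :
    v S ≤ Fintype.card ι / r / β * a + (undercovered r y S).card := by
  have hr' : (0 : ℝ) < r := by exact_mod_cast hr
  set U := undercovered r y S with hU
  have hfiber : ∀ f : Finset (Fin m) → ℝ,
      ∑ T, ((Finset.univ.filter fun i => y i = T).card / r : ℝ) * f T =
        (∑ i, f (y i)) / r := fun f => by
    rw [← Finset.sum_fiberwise Finset.univ y, Finset.sum_div]
    refine Finset.sum_congr rfl fun T _ => ?_
    rw [Finset.sum_congr rfl (g := fun _ => f T)
      fun i hi => by rw [(Finset.mem_filter.1 hi).2]]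
    rw [Finset.sum_const, nsmul_eq_mul]
    ring
  have h := hclose (S \ U) (fun T => ((Finset.univ.filter fun i => y i = T).card / r : ℝ))
    (fun T => by positivity) (fun j hj => by
      rw [Finset.sum_filter]
      have := hfiber fun T => if j ∈ T then 1 else 0
      simp only [mul_ite, mul_one, mul_zero] at this
      rw [this, le_div_iff₀ hr', one_mul, Finset.sum_boole]
      simp only [hU, undercovered, Finset.mem_sdiff, Finset.mem_filter, not_and, not_lt] at hj
      exact_mod_cast hj.2 hj.1)
  rw [hfiber fun T => v (T ∩ (S \ U))] at h
  have hsum : ∑ i, v (y i ∩ (S \ U)) ≤ Fintype.card ι * a := by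
    have := Finset.sum_le_card_nsmul Finset.univ (fun i => v (y i ∩ (S \ U))) a
      fun i _ => (hv.2.1 _ _ Finset.inter_subset_left).trans (hy i)
    rwa [nsmul_eq_mul, Finset.card_univ] at this
  have h2 : v (S \ U) ≤ Fintype.card ι / r / β * a := by
    have : β * v (S \ U) ≤ Fintype.card ι * a / r := h.trans (by gcongr)
    rw [show Fintype.card ι / r / β * a = Fintype.card ι * a / r / β by ring,
      le_div_iff₀ hβ]
    linarith
  have h3 := le_add_card_of_marginal_le_one hmarg (S \ U) U
  rw [Finset.sdiff_union_of_subset (show U ⊆ S from Finset.filter_subset _ _)] at h3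
  linarith

lemma IsBetaCloseXOS.tail_mul_exp_mul_rpow_le_one {m : ℕ} {β : ℝ} {v : Finset (Fin m) → ℝ}
    (hclose : IsBetaCloseXOS m β v) (hβ : 0 < β) (hv : IsValuation m v)
    (hmarg : ∀ (S : Finset (Fin m)) (i : Fin m), v (insert i S) - v S ≤ 1)
    {p : Fin m → ℝ} (hp : ∀ j, 0 ≤ p j ∧ p j ≤ 1) {ψ δ a k s q : ℝ} {r N : ℕ} (ha : 0 < a)
    (hψ : 0 < ψ) (hr0 : 0 < r) (hr : r ≤ N) (hN : (N : ℝ) / r ≤ 1 + δ) (hs : s = r / N)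
    (hq : 0 < q) (h1 : Real.exp (ψ * s * q) - 1 ≤ ψ * (1 - Real.exp (-q)))
    (h2 : s ≤ Real.exp (-q)) :
    subsetProb p univ {S | (1 + δ) / β * a + k ≤ v S} * Real.exp (ψ * s * q * k) *
      subsetProb p univ {S | v S ≤ a} ^ ψ ≤ 1 := by
  have hNpos : (0 : ℝ) < N := by exact_mod_cast hr0.trans_le hr
  have hspos : 0 < s := by
    rw [hs]
    have : (0 : ℝ) < r := by exact_mod_cast hr0
    positivity
  by_cases hP : subsetProb p univ {S | v S ≤ a} = 0
  · rw [hP, Real.zero_rpow hψ.ne']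
    simp
  have hPnn := subsetProb_nonneg (J := univ) hp {S | v S ≤ a}
  have hmain := subsetExp_exp_coverDist_mul_prod_le_one (ι := Fin N) hp hψ hr0 (by simpa using hr)
    (by simpa using hs) hq h1 h2 univ (fun _ => {S | v S ≤ a})
    fun _ S T hTS hS => (hv.2.1 T S hTS).trans hS
  rw [Finset.prod_const, Finset.card_univ, Fintype.card_fin, ← Real.rpow_mul_natCast hPnn,
    div_mul_cancel₀ _ hNpos.ne'] at hmain
  refine le_trans (mul_le_mul_of_nonneg_right ?_ (Real.rpow_nonneg hPnn _)) hmain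
  rw [mul_comm, subsetProb, ← subsetExp_const_mul]
  refine subsetExp_mono hp fun S => ?_
  rw [Set.indicator_apply]
  split_ifs with hS
  · obtain ⟨y, hy, hcard⟩ := exists_card_eq_coverDist (r := r) (ι := Fin N)
      (fun _ => nonempty_of_subsetProb_ne_zero hP) S
    have hle := hclose.le_add_card_undercovered hβ hv hmarg hr0 hy S
    rw [hcard, Fintype.card_fin] at hle
    have hS' : (1 + δ) / β * a + k ≤ v S := hS
    have : (N : ℝ) / r / β * a ≤ (1 + δ) / β * a := by gcongr
    rw [Pi.one_apply, mul_one, Real.exp_le_exp]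
    exact mul_le_mul_of_nonneg_left (by linarith) (by positivity)
  · rw [mul_zero]
    exact (Real.exp_pos _).le

lemma root_slack {ψ D L t : ℝ} (hD : 1 < D) (hψ : D ≤ ψ) (hL : 0 < L)
    (hroot : Real.exp L + ψ * Real.exp (-(L * D / ψ)) = ψ + 1) (ht0 : 0 < t) (ht1 : t < 1) :
    Real.exp (t * L) - 1 < ψ * (1 - Real.exp (-(t * L * D / ψ))) ∧
      D⁻¹ < Real.exp (-(t * L * D / ψ)) := by
  have hD0 : 0 < D := by linarith
  have hψ0 : 0 < ψ := by linarith
  have below : ∀ θ : ℝ, 0 < θ → θ < 1 →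
      Real.exp (θ * L) - 1 < ψ * (1 - Real.exp (-(θ * L * D / ψ))) := fun θ h0 h1 => by
    have e1 := exp_mul_sub_one_lt h0 h1 hL.ne'
    have e2 := exp_mul_sub_one_le h0.le h1.le (-(L * D / ψ))
    rw [show θ * -(L * D / ψ) = -(θ * L * D / ψ) by ring] at e2
    have e3 := mul_le_mul_of_nonneg_left e2 hψ0.le
    have e4 : θ * (Real.exp L - 1) = ψ * (θ * (1 - Real.exp (-(L * D / ψ)))) := by
      linear_combination θ * hroot
    linarith
  refine ⟨below t ht0 ht1, ?_⟩
  have hlogD : 0 < Real.log D := Real.log_pos hD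
  have hbound : L * D / ψ ≤ Real.log D := by
    by_contra! h
    have hθ1 : Real.log D / (L * D / ψ) < 1 := (div_lt_one (hlogD.trans h)).2 h
    have hθ0 : 0 < Real.log D / (L * D / ψ) := by positivity
    have := below _ hθ0 hθ1
    have e1 : Real.log D / (L * D / ψ) * L = Real.log D * (ψ / D) := by field_simp
    have e2 : Real.log D / (L * D / ψ) * L * D / ψ = Real.log D := by field_simp
    rw [e2, e1, Real.exp_neg, Real.exp_log hD0, ← Real.rpow_def_of_pos hD0] at this
    have hb := one_add_mul_self_le_rpow_one_add (s := D - 1) (by linarith)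
      ((one_le_div hD0).2 hψ)
    rw [show 1 + (D - 1) = D by ring] at hb
    have : ψ / D * (D - 1) = ψ * (1 - D⁻¹) := by field_simp
    linarith
  rw [← Real.exp_log hD0, ← Real.exp_neg, Real.exp_lt_exp, Real.exp_log hD0, neg_lt_neg_iff]
  have : t * L * D / ψ = t * (L * D / ψ) := by ring
  have : 0 < L * D / ψ := by positivity
  nlinarith

lemma IsBetaCloseXOS.tail_mul_rpow_mul_rpow_le_one {m : ℕ} {β : ℝ} {v : Finset (Fin m) → ℝ}
    (hclose : IsBetaCloseXOS m β v) (hβ : 0 < β) (hv : IsValuation m v)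
    (hmarg : ∀ (S : Finset (Fin m)) (i : Fin m), v (insert i S) - v S ≤ 1)
    {p : Fin m → ℝ} (hp : ∀ j, 0 ≤ p j ∧ p j ≤ 1) {ψ δ a k ξ : ℝ} (hδ : 0 < δ)
    (hψ : 1 + δ ≤ ψ) (ha : 0 < a) (hξ : 1 < ξ)
    (hroot : ξ + ψ * ξ ^ (-((1 + δ) / ψ)) = ψ + 1) :
    subsetProb p univ {S | (1 + δ) / β * a + k ≤ v S} * ξ ^ k *
      subsetProb p univ {S | v S ≤ a} ^ ψ ≤ 1 := by
  have hξ0 : 0 < ξ := by linarith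
  have hψ0 : 0 < ψ := by linarith
  have hD0 : 0 < 1 + δ := by linarith
  set L := Real.log ξ with hLdef
  have hL : 0 < L := Real.log_pos hξ
  have hroot' : Real.exp L + ψ * Real.exp (-(L * (1 + δ) / ψ)) = ψ + 1 := by
    rw [← hroot, Real.rpow_def_of_pos hξ0, hLdef, Real.exp_log hξ0]
    congr 3
    ring
  have hstep : ∀ t ∈ Set.Ioo (0 : ℝ) 1,
      subsetProb p univ {S | (1 + δ) / β * a + k ≤ v S} * Real.exp (t * L * k) *
        subsetProb p univ {S | v S ≤ a} ^ ψ ≤ 1 := by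
    rintro t ⟨ht0, ht1⟩
    obtain ⟨g1, g2⟩ := root_slack (by linarith) hψ hL hroot' ht0 ht1
    have hlim : Filter.Tendsto (fun n : ℕ => (⌈(1 + δ)⁻¹ * (n : ℝ)⌉₊ : ℝ) / n) Filter.atTop
        (nhds (1 + δ)⁻¹) :=
      (tendsto_nat_ceil_mul_div_atTop (by positivity)).comp tendsto_natCast_atTop_atTop
    have hcont : ContinuousAt (fun s : ℝ => Real.exp (-(t * L / (ψ * s)))) (1 + δ)⁻¹ := by
      have : ψ * (1 + δ)⁻¹ ≠ 0 := by positivity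
      fun_prop (disch := assumption)
    have hval : t * L / (ψ * (1 + δ)⁻¹) = t * L * (1 + δ) / ψ := by field_simp
    have hev1 := hlim.eventually (ContinuousAt.eventually_lt (f := fun _ => Real.exp (t * L) - 1)
      (g := fun s : ℝ => ψ * (1 - Real.exp (-(t * L / (ψ * s))))) continuousAt_const
      (by fun_prop) (by simpa only [hval] using g1))
    have hev2 := hlim.eventually (ContinuousAt.eventually_lt (f := fun s => s)
      (g := fun s : ℝ => Real.exp (-(t * L / (ψ * s)))) continuousAt_id hcont
      (by simpa only [hval] using g2))
    obtain ⟨N, ⟨e1, e2⟩, hN⟩ := ((hev1.and hev2).and (Filter.eventually_gt_atTop 0)).exists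
    have hNpos : (0 : ℝ) < N := by exact_mod_cast hN
    set r := ⌈(1 + δ)⁻¹ * (N : ℝ)⌉₊ with hr
    have hr0 : 0 < r := Nat.ceil_pos.2 (by positivity)
    have hr0' : (0 : ℝ) < r := by exact_mod_cast hr0
    have hrN : r ≤ N := Nat.ceil_le.2 <| by
      have : (1 + δ)⁻¹ ≤ 1 := inv_le_one_of_one_le₀ (by linarith)
      nlinarith
    have hNr : (N : ℝ) / r ≤ 1 + δ := by
      rw [div_le_iff₀ hr0']
      have := Nat.le_ceil ((1 + δ)⁻¹ * (N : ℝ))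
      rwa [inv_mul_le_iff₀ hD0] at this
    have hsimp : ψ * (r / N) * (t * L / (ψ * (r / N))) = t * L := by field_simp
    have := hclose.tail_mul_exp_mul_rpow_le_one (k := k) (q := t * L / (ψ * (r / N)))
      hβ hv hmarg hp ha hψ0 hr0 hrN hNr rfl (by positivity) (by rw [hsimp]; exact e1.le) e2.le
    rwa [hsimp] at this
  have hcont : Continuous fun t : ℝ =>
      subsetProb p univ {S | (1 + δ) / β * a + k ≤ v S} * Real.exp (t * L * k) *
        subsetProb p univ {S | v S ≤ a} ^ ψ := by fun_prop
  have hfin := le_of_tendsto (hcont.continuousWithinAt (s := Set.Iio 1) (x := 1))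
    (Filter.mem_of_superset (Ioo_mem_nhdsLT zero_lt_one) hstep)
  simpa only [one_mul, hLdef, ← Real.rpow_def_of_pos hξ0] using hfin

lemma sum_filter_prodWeight (m : ℕ) (p : Fin m → ℝ) (P : Finset (Fin m) → Prop)
    [DecidablePred P] :
    ∑ S ∈ Finset.univ.filter P, prodWeight m p S = subsetProb p univ {S | P S} := by
  unfold subsetProb subsetExp prodWeight
  rw [Finset.powerset_univ, Finset.sum_filter]
  refine Finset.sum_congr rfl fun S _ => ?_
  simp [Set.indicator_apply, Finset.compl_eq_univ_sdiff]

theorem betaCloseXOS_upperTail (m : ℕ) (β : ℝ) (hβ0 : 0 < β) (hβ1 : β ≤ 1)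
    (v : Finset (Fin m) → ℝ) (hv : IsValuation m v)
    (hmarg : ∀ (S : Finset (Fin m)) (i : Fin m),
      0 ≤ v (insert i S) - v S ∧ v (insert i S) - v S ≤ 1)
    (hclose : IsBetaCloseXOS m β v)
    (p : Fin m → ℝ) (hp : ∀ j, 0 ≤ p j ∧ p j ≤ 1) :
    (∀ ψ δ a k : ℝ, 0 < δ → 1 + δ ≤ ψ → 0 < a → 0 ≤ k →
      ∀ ξ : ℝ, 1 < ξ → ξ + ψ * ξ ^ (-((1 + δ) / ψ)) = ψ + 1 →
        ENNReal.ofReal (∑ S ∈ Finset.univ.filter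
            (fun S : Finset (Fin m) => (1 + δ) / β * a + k ≤ v S), prodWeight m p S) ≤
          ENNReal.ofReal ξ ^ (-k) *
            ENNReal.ofReal (∑ S ∈ Finset.univ.filter
              (fun S : Finset (Fin m) => v S ≤ a), prodWeight m p S) ^ (-ψ)) ∧
    (∀ δ a k : ℝ, 0 < δ → 0 < a → 0 ≤ k →
      (1 / 2 : ℝ) ≤ ∑ S ∈ Finset.univ.filter
          (fun S : Finset (Fin m) => v S ≤ a), prodWeight m p S →
        ∑ S ∈ Finset.univ.filter
            (fun S : Finset (Fin m) => (1 + δ) / β * a + k ≤ v S), prodWeight m p S ≤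
          (1 + δ) ^ (-k) * (2 : ℝ) ^ (1 + δ)) := by
  simp only [sum_filter_prodWeight]
  have hmarg' : ∀ (S : Finset (Fin m)) (i : Fin m), v (insert i S) - v S ≤ 1 :=
    fun S i => (hmarg S i).2
  have hnn := fun A => subsetProb_nonneg (J := univ) hp A
  constructor
  · intro ψ δ a k hδ hψ ha hk ξ hξ hroot
    have hψ0 : 0 < ψ := by linarith
    have hξ0 : 0 < ξ := by linarith
    have h := hclose.tail_mul_rpow_mul_rpow_le_one (k := k) hβ0 hv hmarg' hp hδ hψ ha hξ hroot
    rcases (hnn {S | v S ≤ a}).eq_or_lt with hP | hP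
    · rw [← hP, ENNReal.ofReal_zero, ENNReal.zero_rpow_of_neg (by linarith), ENNReal.mul_top]
      · exact le_top
      · rw [ENNReal.ofReal_rpow_of_pos hξ0]
        simpa using Real.rpow_pos_of_pos hξ0 (-k)
    · rw [ENNReal.ofReal_rpow_of_pos hξ0, ENNReal.ofReal_rpow_of_pos hP,
        ← ENNReal.ofReal_mul (Real.rpow_nonneg hξ0.le _)]
      refine ENNReal.ofReal_le_ofReal ?_
      rw [Real.rpow_neg hξ0.le, Real.rpow_neg hP.le, ← mul_inv, ← one_div,
        le_div_iff₀ (mul_pos (Real.rpow_pos_of_pos hξ0 _) (Real.rpow_pos_of_pos hP _)),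
        ← mul_assoc]
      exact h
  · intro δ a k hδ ha hk hP
    have hD0 : 0 < 1 + δ := by linarith
    have hroot : (1 + δ) + (1 + δ) * (1 + δ) ^ (-((1 + δ) / (1 + δ))) = (1 + δ) + 1 := by
      rw [div_self hD0.ne', Real.rpow_neg_one, mul_inv_cancel₀ hD0.ne']
    have h := hclose.tail_mul_rpow_mul_rpow_le_one (k := k) hβ0 hv hmarg' hp hδ le_rfl ha
      (by linarith) hroot
    have hpow : ((1 / 2 : ℝ)) ^ (1 + δ) ≤ subsetProb p univ {S | v S ≤ a} ^ (1 + δ) :=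
      Real.rpow_le_rpow (by norm_num) hP hD0.le
    have hk0 : 0 < (1 + δ) ^ k := Real.rpow_pos_of_pos hD0 k
    have h2 : (0 : ℝ) < 2 ^ (1 + δ) := Real.rpow_pos_of_pos two_pos _
    have h3 := (mul_le_mul_of_nonneg_left hpow (mul_nonneg (hnn _) hk0.le)).trans h
    rw [one_div, Real.inv_rpow zero_le_two, ← div_eq_mul_inv, div_le_one h2] at h3
    rw [Real.rpow_neg hD0.le, inv_mul_eq_div, le_div_iff₀ hk0]
    exact h3
end

section
/- Let Ω = ∏_{i=1}^N Ω_i be a product of discrete probability spaces with product probability measure P, let q ≥ 2 and 1 ≤ s < q be integers, let α ≥ 1/s be real, and let t(α,q,s) be the larger root of the equation t + αq·t^{−1/(αs)} = αq + 1. Then for any subsets A_1,…,A_q ⊆ Ω of positive measure: ∫_Ω t(α,q,s)^{f^s(A_1,…,A_q; x)} dP(x) ≤ ∏_{i=1}^q P[A_i]^{−α}. In particular, taking A_1 = ⋯ = A_q = A, α = 1/s, and t = q/s: P[ f^s(A,…,A; x) ≥ k ] ≤ (q/s)^{−k} · P[A]^{−q/s} for every k ≥ 0. -/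
open MeasureTheory
open scoped Classical ENNReal

/-- Talagrand's "control by `q` points" function: the number of coordinates `i` such that
`x i` appears fewer than `s` times in the multiset `{y 0 i, …, y (q-1) i}`. -/
noncomputable def fpts {N q : ℕ} {Ω : Fin N → Type*} (s : ℕ)
    (y : Fin q → ∀ i, Ω i) (x : ∀ i, Ω i) : ℕ :=
  (Finset.univ.filter fun i : Fin N =>
    (Finset.univ.filter fun j : Fin q => y j i = x i).card < s).card

/-- The set version: the infimum of `fpts s y x` over all choices `y j ∈ A j`. -/
noncomputable def fsets {N q : ℕ} {Ω : Fin N → Type*} (s : ℕ)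
    (A : Fin q → Set (∀ i, Ω i)) (x : ∀ i, Ω i) : ℕ :=
  sInf {n : ℕ | ∃ y : Fin q → ∀ i, Ω i, (∀ j, y j ∈ A j) ∧ n = fpts s y x}

/-- The graph of `u ↦ exp (c * u) - 1` lies below its chords through the origin. -/
lemma mul_exp_sub_one_le {c u v : ℝ} (hu : 0 ≤ u) (huv : u ≤ v) :
    v * (Real.exp (c * u) - 1) ≤ u * (Real.exp (c * v) - 1) := by
  rcases (hu.trans huv).eq_or_lt with hv | hv
  · obtain rfl : u = 0 := by linarith
    simp
  · have h := convexOn_exp.2 (Set.mem_univ (c * v)) (Set.mem_univ 0)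
      (div_nonneg hu hv.le) (sub_nonneg.2 ((div_le_one hv).2 huv)) (add_sub_cancel _ _)
    have h1 : u / v * (c * v) = c * u := by field_simp
    simp only [smul_eq_mul, mul_zero, add_zero, h1, Real.exp_zero, mul_one] at h
    have h2 := mul_le_mul_of_nonneg_left h hv.le
    have h3 : v * (u / v * Real.exp (c * v) + (1 - u / v)) = u * Real.exp (c * v) + (v - u) := by
      field_simp
    linarith

lemma mul_exp_le_of_root {α q s x : ℝ} (hs : 0 < s) (hα : 1 ≤ α * s) (hx : 0 < x)
    (hE : Real.exp (α * s * x) - 1 = α * q * (1 - Real.exp (-x))) :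
    s * Real.exp x ≤ q := by
  have hα0 : 0 < α := by
    by_contra! h
    nlinarith
  have h := mul_exp_sub_one_le (c := 1) hx.le (le_mul_of_one_le_left hx.le hα)
  simp only [one_mul, hE] at h
  have hZ : 1 < Real.exp x := Real.one_lt_exp_iff.2 hx
  have hZ' : Real.exp (-x) * Real.exp x = 1 := by rw [← Real.exp_add]; simp
  have h1 : s * (Real.exp x - 1) ≤ q * (1 - Real.exp (-x)) := by
    refine le_of_mul_le_mul_left ?_ (mul_pos hx hα0)
    linarith
  refine le_of_mul_le_mul_right ?_ (sub_pos.2 hZ)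
  have h2 := mul_le_mul_of_nonneg_right h1 (Real.exp_pos x).le
  linear_combination h2 - q * hZ'

lemma mul_one_sub_exp_le {q s κ z : ℝ} (hκ : 0 < κ) (hκs : κ ≤ s) (hz : 0 ≤ z)
    (hq : s * Real.exp z ≤ q) :
    q * (1 - Real.exp (-z)) ≤ (κ + (q - s)) * (1 - Real.exp (-(s * z / κ))) := by
  rcases hz.eq_or_lt with rfl | hz
  · simp
  have hzv : z ≤ s * z / κ := by
    rw [le_div_iff₀ hκ]
    nlinarith
  have hB : s * (Real.exp z - 1) ≤ κ * (Real.exp (s * z / κ) - 1) := by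
    have h := mul_exp_sub_one_le (c := 1) hz.le hzv
    simp only [one_mul] at h
    refine le_of_mul_le_mul_left ?_ hz
    have h2 := mul_le_mul_of_nonneg_left h hκ.le
    have h3 : κ * (s * z / κ * (Real.exp z - 1)) = s * z * (Real.exp z - 1) := by field_simp
    linarith
  have hZW := Real.exp_le_exp.2 hzv
  rw [Real.exp_neg, Real.exp_neg]
  have hZ := Real.exp_pos z
  have hW := Real.exp_pos (s * z / κ)
  generalize Real.exp z = Z at *
  generalize Real.exp (s * z / κ) = W at *
  have h1 : (κ + (q - s)) * (1 - W⁻¹) - q * (1 - Z⁻¹) =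
      ((q - s * Z) * (W - Z) + Z * (κ * (W - 1) - s * (Z - 1))) / (W * Z) := by
    field_simp
    ring
  rw [← sub_nonneg, h1]
  have := mul_nonneg (sub_nonneg.2 hq) (sub_nonneg.2 hZW)
  have := mul_nonneg hZ.le (sub_nonneg.2 hB)
  positivity

lemma min_exp_sub_one_le {α q s x κ Y : ℝ} (hs : 0 < s) (hsq : s ≤ q) (hα : 1 ≤ α * s)
    (hx : 0 < x) (hE : Real.exp (α * s * x) - 1 = α * q * (1 - Real.exp (-x)))
    (hκ : 0 < κ) (hκs : κ ≤ s) (hY : 0 ≤ Y) :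
    min (Real.exp (α * s * x)) (Real.exp (α * Y)) - 1 ≤
      α * ((κ + (q - s)) * (1 - Real.exp (-(Y / κ)))) := by
  have hα0 : 0 < α := by
    by_contra! h
    nlinarith
  have hq := mul_exp_le_of_root hs hα hx hE
  rcases le_total Y (s * x) with h | h
  · set z := Y / s with hz
    have hYz : Y = s * z := by rw [hz]; field_simp
    have hz0 : 0 ≤ z := by positivity
    have hzx : z ≤ x := by rw [hz, div_le_iff₀ hs]; linarith
    have h1 := mul_one_sub_exp_le hκ hκs hz0
      ((mul_le_mul_of_nonneg_left (Real.exp_le_exp.2 hzx) hs.le).trans hq)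
    rw [hYz]
    have h2 := mul_exp_sub_one_le (c := α * s) hz0 hzx
    have h3 := mul_exp_sub_one_le (c := -1) hz0 hzx
    simp only [neg_mul, one_mul] at h3
    rw [hE] at h2
    have h4 : Real.exp (α * (s * z)) - 1 ≤ α * (q * (1 - Real.exp (-z))) := by
      refine le_of_mul_le_mul_left ?_ hx
      rw [← mul_assoc α s z]
      have : 0 ≤ α * q := mul_nonneg hα0.le (hs.le.trans hsq)
      nlinarith [mul_le_mul_of_nonneg_left h3 this]
    have h5 := mul_le_mul_of_nonneg_left h1 hα0.le
    linarith [min_le_right (Real.exp (α * s * x)) (Real.exp (α * (s * z)))]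
  · have h1 := mul_le_mul_of_nonneg_left (mul_one_sub_exp_le hκ hκs hx.le hq) hα0.le
    have h2 : Real.exp (-(Y / κ)) ≤ Real.exp (-(s * x / κ)) := by gcongr
    have h3 : (κ + (q - s)) * (1 - Real.exp (-(s * x / κ))) ≤
        (κ + (q - s)) * (1 - Real.exp (-(Y / κ))) :=
      mul_le_mul_of_nonneg_left (by linarith) (by linarith)
    have h4 := mul_le_mul_of_nonneg_left h3 hα0.le
    linarith [min_le_left (Real.exp (α * s * x)) (Real.exp (α * Y))]

lemma exists_card_eq_forall_notMem_le {ι : Type*} [Fintype ι] (g : ι → ℝ) {s : ℕ}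
    (hs : s ≤ Fintype.card ι) :
    ∃ I : Finset ι, I.card = s ∧ ∀ i ∈ I, ∀ j ∉ I, g j ≤ g i := by
  induction s with
  | zero => exact ⟨∅, by simp⟩
  | succ s ih =>
    obtain ⟨I, hI, h⟩ := ih (by omega)
    have hne : (Iᶜ).Nonempty := by
      rw [← Finset.card_pos, Finset.card_compl]
      omega
    obtain ⟨k, hk, hmax⟩ := Finset.exists_max_image Iᶜ g hne
    rw [Finset.mem_compl] at hk
    refine ⟨insert k I, by rw [Finset.card_insert_of_notMem hk, hI], fun i hi j hj => ?_⟩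
    rw [Finset.mem_insert, not_or] at hj
    rcases Finset.mem_insert.1 hi with rfl | hi
    · exact hmax j (Finset.mem_compl.2 hj.2)
    · exact h i hi j hj.2

/-- The pointwise inequality behind the induction on the number of coordinates: the `s` largest
values of `g` dominate the defect `∑ j, (1 - g j)`. -/
lemma exists_card_eq_min_le {q s : ℕ} (hs : 1 ≤ s) (hsq : s < q) {α x : ℝ} (hα : 1 ≤ α * s)
    (hx : 0 < x) (hE : Real.exp (α * s * x) - 1 = α * q * (1 - Real.exp (-x)))
    {g : Fin q → ℝ} (hg0 : ∀ j, 0 ≤ g j) (hg1 : ∀ j, g j ≤ 1) :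
    ∃ I : Finset (Fin q), I.card = s ∧
      (Real.exp (α * s * x) ≤ 1 + α * ∑ j, (1 - g j) ∨
        (∀ i ∈ I, 0 < g i) ∧ ∏ i ∈ I, g i ^ (-α) ≤ 1 + α * ∑ j, (1 - g j)) := by
  have hs0 : (0 : ℝ) < s := by exact_mod_cast hs
  have hsq' : (s : ℝ) ≤ q := by exact_mod_cast hsq.le
  have hα0 : 0 < α := by
    by_contra! h
    nlinarith
  obtain ⟨I, hI, hdom⟩ := exists_card_eq_forall_notMem_le g (s := s) (by simpa using hsq.le)
  refine ⟨I, hI, ?_⟩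
  obtain ⟨k, hk, hmin⟩ := Finset.exists_min_image I g (Finset.card_pos.1 (by omega))
  have hcompl : ((q : ℝ) - s) * (1 - g k) ≤ ∑ j ∈ Iᶜ, (1 - g j) := by
    have h := Finset.card_nsmul_le_sum Iᶜ (fun j => 1 - g j) (1 - g k) fun j hj => by
      linarith [hdom k hk j (Finset.mem_compl.1 hj)]
    rwa [Finset.card_compl, Fintype.card_fin, hI, nsmul_eq_mul, Nat.cast_sub hsq.le] at h
  have hsum : ∑ j, (1 - g j) = ∑ j ∈ I, (1 - g j) + ∑ j ∈ Iᶜ, (1 - g j) :=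
    (Finset.sum_add_sum_compl I _).symm
  rcases (hg0 k).eq_or_lt with h0 | h0
  · left
    have h1 := min_exp_sub_one_le (κ := 1) (Y := s * x) hs0 hsq' hα hx hE one_pos
      (by exact_mod_cast hs) (by positivity)
    rw [← mul_assoc α, min_self] at h1
    have h2 : 1 - g k ≤ ∑ j ∈ I, (1 - g j) :=
      Finset.single_le_sum (f := fun j => 1 - g j) (fun j _ => by linarith [hg1 j]) hk
    have h3 : (1 + ((q : ℝ) - s)) * (1 - Real.exp (-(s * x / 1))) ≤ ∑ j, (1 - g j) := by
      rw [← h0] at h2 hcompl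
      have : 0 < (1 + ((q : ℝ) - s)) * Real.exp (-(s * x / 1)) :=
        mul_pos (by linarith) (Real.exp_pos _)
      linarith
    linarith [mul_le_mul_of_nonneg_left h3 hα0.le]
  have hpos : ∀ i ∈ I, 0 < g i := fun i hi => h0.trans_le (hmin i hi)
  set y : Fin q → ℝ := fun i => -Real.log (g i) with hy
  have hgy : ∀ i ∈ I, g i = Real.exp (-y i) := fun i hi => by simp [hy, Real.exp_log (hpos i hi)]
  have hy0 : ∀ i, 0 ≤ y i := fun i => neg_nonneg.2 (Real.log_nonpos (hg0 i) (hg1 i))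
  have hyk : ∀ i ∈ I, y i ≤ y k := fun i hi => neg_le_neg (Real.log_le_log h0 (hmin i hi))
  have hprod : ∏ i ∈ I, g i ^ (-α) = Real.exp (α * ∑ i ∈ I, y i) := by
    rw [Finset.mul_sum, Real.exp_sum]
    refine Finset.prod_congr rfl fun i hi => ?_
    rw [Real.rpow_def_of_pos (hpos i hi)]
    congr 1
    simp only [hy]
    ring
  have hnn : 0 ≤ ∑ j, (1 - g j) := Finset.sum_nonneg fun j _ => by linarith [hg1 j]
  suffices h : min (Real.exp (α * s * x)) (Real.exp (α * ∑ i ∈ I, y i)) ≤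
      1 + α * ∑ j, (1 - g j) by
    rcases min_le_iff.1 h with h | h
    · exact Or.inl h
    · exact Or.inr ⟨hpos, hprod ▸ h⟩
  have hY0 : 0 ≤ ∑ i ∈ I, y i := Finset.sum_nonneg fun i _ => hy0 i
  rcases (hy0 k).eq_or_lt with hk0 | hk0
  · have : ∑ i ∈ I, y i = 0 := Finset.sum_eq_zero fun i hi =>
      le_antisymm (hk0 ▸ hyk i hi) (hy0 i)
    rw [this, mul_zero, Real.exp_zero]
    exact (min_le_right _ _).trans (by linarith [mul_nonneg hα0.le hnn])
  have hYs : ∑ i ∈ I, y i ≤ s * y k := by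
    simpa [hI] using Finset.sum_le_card_nsmul I y (y k) hyk
  have hYk : y k ≤ ∑ i ∈ I, y i := Finset.single_le_sum (fun i _ => hy0 i) hk
  have hκ : 0 < (∑ i ∈ I, y i) / y k := div_pos (hk0.trans_le hYk) hk0
  have h1 := min_exp_sub_one_le hs0 hsq' hα hx hE hκ ((div_le_iff₀ hk0).2 hYs) hY0
  have h2 : (∑ i ∈ I, y i) / ((∑ i ∈ I, y i) / y k) = y k := by
    have := hk0.trans_le hYk
    field_simp
  rw [h2, ← hgy k hk] at h1
  have h3 : (∑ i ∈ I, y i) / y k * (1 - g k) ≤ ∑ j ∈ I, (1 - g j) := by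
    rw [div_mul_eq_mul_div, div_le_iff₀ hk0, Finset.sum_mul, Finset.sum_mul]
    refine Finset.sum_le_sum fun i hi => ?_
    have h := mul_exp_sub_one_le (c := -1) (hy0 i) (hyk i hi)
    simp only [neg_mul, one_mul, ← hgy i hi, ← hgy k hk] at h
    linarith
  have h4 : ((∑ i ∈ I, y i) / y k + ((q : ℝ) - s)) * (1 - g k) ≤ ∑ j, (1 - g j) := by
    rw [hsum, add_mul]
    exact add_le_add h3 hcompl
  linarith [mul_le_mul_of_nonneg_left h4 hα0.le]

lemma fpts_cons {N q : ℕ} {Ω : Fin (N + 1) → Type*} (s : ℕ) (w : Fin q → Ω 0)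
    (z : Fin q → ∀ i : Fin N, Ω i.succ) (ω : Ω 0) (x : ∀ i : Fin N, Ω i.succ) :
    fpts s (fun j => Fin.cons (w j) (z j)) (Fin.cons ω x : ∀ i, Ω i) =
      (if (Finset.univ.filter fun j => w j = ω).card < s then 1 else 0) + fpts s z x := by
  simp only [fpts, Finset.card_filter _ (Finset.univ : Finset (Fin _)), Fin.sum_univ_succ,
    Fin.cons_zero, Fin.cons_succ]

lemma exists_fpts_eq_fsets {N q : ℕ} {Ω : Fin N → Type*} (s : ℕ)
    {A : Fin q → Set (∀ i, Ω i)} (hA : ∀ j, (A j).Nonempty) (x : ∀ i, Ω i) :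
    ∃ y : Fin q → ∀ i, Ω i, (∀ j, y j ∈ A j) ∧ fsets s A x = fpts s y x := by
  choose y hy using hA
  exact Nat.sInf_mem (s := {n : ℕ | ∃ y : Fin q → ∀ i, Ω i, (∀ j, y j ∈ A j) ∧ n = fpts s y x})
    ⟨_, y, hy, rfl⟩

lemma fsets_le_fpts {N q : ℕ} {Ω : Fin N → Type*} (s : ℕ) {A : Fin q → Set (∀ i, Ω i)}
    {y : Fin q → ∀ i, Ω i} (hy : ∀ j, y j ∈ A j) (x : ∀ i, Ω i) :
    fsets s A x ≤ fpts s y x :=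
  Nat.sInf_le ⟨y, hy, rfl⟩

lemma fsets_cons_le_one_add {N q : ℕ} {Ω : Fin (N + 1) → Type*} (s : ℕ)
    {A : Fin q → Set (∀ i, Ω i)} {B : Fin q → Set (∀ i : Fin N, Ω i.succ)}
    (hB : ∀ j, ∀ z ∈ B j, ∃ w, (Fin.cons w z : ∀ i, Ω i) ∈ A j) (hne : ∀ j, (B j).Nonempty)
    (ω : Ω 0) (x : ∀ i : Fin N, Ω i.succ) :
    fsets s A (Fin.cons ω x) ≤ 1 + fsets s B x := by
  obtain ⟨z, hz, h⟩ := exists_fpts_eq_fsets s hne x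
  choose w hw using fun j => hB j (z j) (hz j)
  refine (fsets_le_fpts s hw _).trans ?_
  rw [fpts_cons, h]
  split_ifs <;> omega

lemma fsets_cons_le {N q : ℕ} {Ω : Fin (N + 1) → Type*} {s : ℕ}
    {A : Fin q → Set (∀ i, Ω i)} {C : Fin q → Set (∀ i : Fin N, Ω i.succ)}
    {I : Finset (Fin q)} (hI : I.card = s) (ω : Ω 0)
    (hCI : ∀ j ∈ I, ∀ z ∈ C j, (Fin.cons ω z : ∀ i, Ω i) ∈ A j)
    (hC : ∀ j, ∀ z ∈ C j, ∃ w, (Fin.cons w z : ∀ i, Ω i) ∈ A j) (hne : ∀ j, (C j).Nonempty)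
    (x : ∀ i : Fin N, Ω i.succ) :
    fsets s A (Fin.cons ω x) ≤ fsets s C x := by
  obtain ⟨z, hz, h⟩ := exists_fpts_eq_fsets s hne x
  have hw : ∀ j, ∃ w, (Fin.cons w (z j) : ∀ i, Ω i) ∈ A j ∧ (j ∈ I → w = ω) := fun j => by
    by_cases hj : j ∈ I
    · exact ⟨ω, hCI j hj _ (hz j), fun _ => rfl⟩
    · obtain ⟨w, hw⟩ := hC j _ (hz j)
      exact ⟨w, hw, fun h => absurd h hj⟩
  choose w hw hwI using hw
  refine (fsets_le_fpts s hw _).trans ?_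
  have hcard : s ≤ (Finset.univ.filter fun j => w j = ω).card :=
    hI ▸ Finset.card_le_card fun j hj => by simpa using hwI j hj
  rw [fpts_cons, h, if_neg hcard.not_gt, zero_add]

/-- Tensorization step: the linear bound `1 + α * ∑ j, (1 - c j)` is at most `∏ j, c j ^ (-α)`. -/
lemma one_add_mul_sum_le_prod_rpow_s14 {q : ℕ} {α : ℝ} (hα : 0 ≤ α) {c : Fin q → ℝ}
    (hc : ∀ j, 0 < c j) : 1 + α * ∑ j, (1 - c j) ≤ ∏ j, c j ^ (-α) := by
  have h : ∏ j, c j ^ (-α) = Real.exp (α * ∑ j, -Real.log (c j)) := by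
    rw [Finset.mul_sum, Real.exp_sum]
    refine Finset.prod_congr rfl fun i _ => ?_
    rw [Real.rpow_def_of_pos (hc i)]
    congr 1
    ring
  have h1 : ∑ j, (1 - c j) ≤ ∑ j, -Real.log (c j) :=
    Finset.sum_le_sum fun j _ => by linarith [Real.log_le_sub_one_of_pos (hc j)]
  rw [h]
  linarith [mul_le_mul_of_nonneg_left h1 hα, Real.add_one_le_exp (α * ∑ j, -Real.log (c j))]

lemma measurePreserving_finCons {N : ℕ} {Ω : Fin (N + 1) → Type*} [∀ i, MeasurableSpace (Ω i)]
    (μ : ∀ i, Measure (Ω i)) [∀ i, IsProbabilityMeasure (μ i)] :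
    MeasurePreserving (fun p : Ω 0 × (∀ i : Fin N, Ω i.succ) => (Fin.cons p.1 p.2 : ∀ i, Ω i))
      ((μ 0).prod (Measure.pi fun i => μ i.succ)) (Measure.pi μ) := by
  have hm : Measurable
      (fun p : Ω 0 × (∀ i : Fin N, Ω i.succ) => (Fin.cons p.1 p.2 : ∀ i, Ω i)) := by
    refine measurable_pi_lambda _ fun i => ?_
    refine Fin.cases ?_ (fun j => ?_) i
    · simpa using measurable_fst
    · simp only [Fin.cons_succ]
      exact (measurable_pi_apply j).comp measurable_snd
  refine ⟨hm, (Measure.pi_eq fun S hS => ?_).symm⟩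
  have : (fun p : Ω 0 × (∀ i : Fin N, Ω i.succ) => (Fin.cons p.1 p.2 : ∀ i, Ω i)) ⁻¹'
      Set.univ.pi S = S 0 ×ˢ Set.univ.pi fun i : Fin N => S i.succ := by
    ext p
    simp [Set.mem_pi, Fin.forall_fin_succ]
  rw [Measure.map_apply hm (MeasurableSet.univ_pi hS), this, Measure.prod_prod, Measure.pi_pi,
    Fin.prod_univ_succ]

/-- Integrating the tangent-line bound from `exists_card_eq_min_le` over one coordinate. -/
lemma lintegral_one_add_mul_sum_le {q : ℕ} {X : Type*} [MeasurableSpace X]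
    [DiscreteMeasurableSpace X] (μ : Measure X) [IsProbabilityMeasure μ] {α : ℝ} (hα : 0 ≤ α)
    {a : Fin q → X → ℝ≥0∞} {b : Fin q → ℝ≥0∞} (hab : ∀ j ω, a j ω ≤ b j) (hb : ∀ j, b j ≠ ∞)
    (ha : ∀ j, ∫⁻ ω, a j ω ∂μ ≠ 0) :
    (∏ j, b j ^ (-α)) *
        ∫⁻ ω, ENNReal.ofReal (1 + α * ∑ j, (1 - (a j ω / b j).toReal)) ∂μ ≤
      ∏ j, (∫⁻ ω, a j ω ∂μ) ^ (-α) := by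
  have hle : ∀ j, ∫⁻ ω, a j ω ∂μ ≤ b j := fun j =>
    (lintegral_mono (hab j)).trans (by simp)
  have hb0 : ∀ j, b j ≠ 0 := fun j h => ha j (by simpa [h] using hle j)
  have hdiv : ∀ j ω, a j ω / b j ≤ 1 := fun j ω => ENNReal.div_le_of_le_mul (by simpa using hab j ω)
  have hdiv' : ∀ j ω, (a j ω / b j).toReal ≤ 1 := fun j ω =>
    ENNReal.toReal_le_of_le_ofReal zero_le_one (by simpa using hdiv j ω)
  have hint : ∀ j, Integrable (fun ω => (a j ω / b j).toReal) μ := fun j =>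
    .of_bound Measurable.of_discrete.aestronglyMeasurable 1
      (.of_forall fun ω => by simpa using hdiv' j ω)
  have hint' : ∀ j, Integrable (fun ω => 1 - (a j ω / b j).toReal) μ := fun j =>
    (integrable_const _).sub (hint j)
  have hc : ∀ j, ∫ ω, (a j ω / b j).toReal ∂μ = ((∫⁻ ω, a j ω ∂μ) / b j).toReal := fun j => by
    rw [integral_toReal Measurable.of_discrete.aemeasurable
      (.of_forall fun ω => (hdiv j ω).trans_lt ENNReal.one_lt_top)]
    simp only [div_eq_mul_inv]
    rw [lintegral_mul_const _ .of_discrete]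
  have hcpos : ∀ j, 0 < ((∫⁻ ω, a j ω ∂μ) / b j).toReal := fun j =>
    ENNReal.toReal_pos (ENNReal.div_ne_zero.2 ⟨ha j, hb j⟩)
      (ENNReal.div_ne_top ((hle j).trans_lt (hb j).lt_top).ne (hb0 j))
  rw [← ofReal_integral_eq_lintegral_ofReal
    (f := fun ω => 1 + α * ∑ j, (1 - (a j ω / b j).toReal))
    ((integrable_const _).add ((integrable_finsetSum _ fun j _ => hint' j).const_mul α))
    (.of_forall fun ω => add_nonneg zero_le_one
      (mul_nonneg hα (Finset.sum_nonneg fun j _ => sub_nonneg.2 (hdiv' j ω))))]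
  have hI : ∫ ω, (1 + α * ∑ j, (1 - (a j ω / b j).toReal)) ∂μ =
      1 + α * ∑ j, (1 - ((∫⁻ ω, a j ω ∂μ) / b j).toReal) := by
    rw [integral_add (integrable_const _)
      ((integrable_finsetSum _ fun j _ => hint' j).const_mul α), integral_const_mul,
      integral_finsetSum _ fun j _ => hint' j]
    refine congrArg₂ _ (by simp) (congrArg _ (Finset.sum_congr rfl fun j _ => ?_))
    rw [integral_sub (integrable_const _) (hint j), hc]
    simp
  rw [hI]
  refine (mul_le_mul_right (ENNReal.ofReal_le_ofReal
    (one_add_mul_sum_le_prod_rpow_s14 hα hcpos)) _).trans ?_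
  rw [ENNReal.ofReal_prod_of_nonneg fun j _ => Real.rpow_nonneg (hcpos j).le _,
    ← Finset.prod_mul_distrib]
  refine (Finset.prod_congr rfl fun j _ => ?_).le
  have htop : (∫⁻ ω, a j ω ∂μ) / b j ≠ ∞ :=
    ENNReal.div_ne_top ((hle j).trans_lt (hb j).lt_top).ne (hb0 j)
  rw [← ENNReal.ofReal_rpow_of_pos (hcpos j), ENNReal.ofReal_toReal htop,
    ← ENNReal.mul_rpow_of_ne_top (hb j) htop, ENNReal.mul_div_cancel (hb0 j) (hb j)]

theorem lintegral_pow_fsets_le {q s : ℕ} (hs : 1 ≤ s) (hsq : s < q) {α x : ℝ}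
    (hα : 1 ≤ α * s) (hx : 0 < x)
    (hE : Real.exp (α * s * x) - 1 = α * q * (1 - Real.exp (-x)))
    {N : ℕ} {Ω : Fin N → Type*} [∀ i, Countable (Ω i)]
    [∀ i, MeasurableSpace (Ω i)] [∀ i, MeasurableSingletonClass (Ω i)]
    (μ : ∀ i, Measure (Ω i)) [∀ i, IsProbabilityMeasure (μ i)]
    (A : Fin q → Set (∀ i, Ω i)) (hA : ∀ j, 0 < Measure.pi μ (A j)) :
    ∫⁻ z, ENNReal.ofReal (Real.exp (α * s * x)) ^ fsets s A z ∂Measure.pi μ ≤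
      ∏ j, Measure.pi μ (A j) ^ (-α) := by
  induction N with
  | zero =>
    have hne : ∀ j, (A j).Nonempty := fun j => nonempty_of_measure_ne_zero (hA j).ne'
    have h0 : ∀ z, fsets s A z = 0 := fun z => by
      obtain ⟨y, -, h⟩ := exists_fpts_eq_fsets s hne z
      simp [h, fpts]
    have h1 : ∀ j, A j = Set.univ := fun j => Subsingleton.eq_univ_of_nonempty (hne j)
    simp [h0, h1]
  | succ N ih =>
    have hα0 : 0 ≤ α := by
      by_contra! h
      have : (0 : ℝ) ≤ s := s.cast_nonneg
      nlinarith
    set t := ENNReal.ofReal (Real.exp (α * s * x)) with ht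
    have ht1 : 1 ≤ t := ENNReal.one_le_ofReal.2 (Real.one_le_exp (by positivity))
    set P := Measure.pi fun i : Fin N => μ i.succ with hP
    set D : Fin q → Ω 0 → Set (∀ i : Fin N, Ω i.succ) :=
      fun j ω => {z | (Fin.cons ω z : ∀ i, Ω i) ∈ A j} with hD
    set B : Fin q → Set (∀ i : Fin N, Ω i.succ) := fun j => ⋃ ω, D j ω with hB
    have hmp := measurePreserving_finCons μ
    have hPA : ∀ j, ∫⁻ ω, P (D j ω) ∂μ 0 = Measure.pi μ (A j) := fun j => by
      rw [← hmp.measure_preimage (MeasurableSet.of_discrete).nullMeasurableSet,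
        Measure.prod_apply .of_discrete]
      rfl
    have hBA : ∀ j, ∀ z ∈ B j, ∃ w, (Fin.cons w z : ∀ i, Ω i) ∈ A j := fun j z hz =>
      Set.mem_iUnion.1 hz
    have hDB : ∀ j ω, P (D j ω) ≤ P (B j) := fun j ω => measure_mono (Set.subset_iUnion _ ω)
    have hBpos : ∀ j, 0 < P (B j) := fun j => by
      refine (hA j).trans_le ?_
      rw [← hPA]
      exact (lintegral_mono (hDB j)).trans (by simp)
    have hBne : ∀ j, (B j).Nonempty := fun j => nonempty_of_measure_ne_zero (hBpos j).ne'
    have hstep : ∀ ω, ∫⁻ z, t ^ fsets s A (Fin.cons ω z : ∀ i, Ω i) ∂P ≤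
        (∏ j, P (B j) ^ (-α)) *
          ENNReal.ofReal (1 + α * ∑ j, (1 - (P (D j ω) / P (B j)).toReal)) := fun ω => by
      obtain ⟨I, hI, h | ⟨hpos, h⟩⟩ := exists_card_eq_min_le hs hsq hα hx hE
        (g := fun j => (P (D j ω) / P (B j)).toReal) (fun j => ENNReal.toReal_nonneg)
        (fun j => ENNReal.toReal_le_of_le_ofReal zero_le_one
          (by simpa using ENNReal.div_le_of_le_mul (by simpa using hDB j ω)))
      · calc ∫⁻ z, t ^ fsets s A (Fin.cons ω z : ∀ i, Ω i) ∂P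
            ≤ ∫⁻ z, t * t ^ fsets s B z ∂P := lintegral_mono fun z => by
              rw [← pow_succ']
              exact pow_le_pow_right₀ ht1 ((fsets_cons_le_one_add s hBA hBne ω z).trans_eq
                (add_comm _ _))
          _ = t * ∫⁻ z, t ^ fsets s B z ∂P := lintegral_const_mul _ .of_discrete
          _ ≤ _ := by
              rw [mul_comm]
              exact mul_le_mul' (ih (fun i => μ i.succ) B hBpos) (ENNReal.ofReal_le_ofReal h)
      · set C : Fin q → Set (∀ i : Fin N, Ω i.succ) :=
          fun j => if j ∈ I then D j ω else B j with hC
        have hCpos : ∀ j, 0 < P (C j) := fun j => by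
          by_cases hj : j ∈ I
          · have h1 := (ENNReal.toReal_pos_iff.1 (hpos j hj)).1
            simp only [hC, hj, if_true]
            exact pos_iff_ne_zero.2 fun h0 => by simp [h0] at h1
          · simpa [hC, hj] using hBpos j
        have hCA : ∀ j, ∀ z ∈ C j, ∃ w, (Fin.cons w z : ∀ i, Ω i) ∈ A j := fun j z hz => by
          by_cases hj : j ∈ I
          · exact ⟨ω, by simp only [hC, hj, if_true] at hz; exact hz⟩
          · exact hBA j z (by simpa only [hC, hj, if_false] using hz)
        have hCI : ∀ j ∈ I, ∀ z ∈ C j, (Fin.cons ω z : ∀ i, Ω i) ∈ A j := fun j hj z hz => by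
          simp only [hC, hj, if_true] at hz
          exact hz
        have hle : ∀ z, fsets s A (Fin.cons ω z : ∀ i, Ω i) ≤ fsets s C z :=
          fsets_cons_le hI ω hCI hCA fun j => nonempty_of_measure_ne_zero (hCpos j).ne'
        refine (lintegral_mono fun z => pow_le_pow_right₀ ht1 (hle z)).trans
          ((ih (fun i => μ i.succ) C hCpos).trans ?_)
        refine le_trans (le_of_eq ?_) (mul_le_mul_right (ENNReal.ofReal_le_ofReal h) _)
        rw [ENNReal.ofReal_prod_of_nonneg fun j _ => Real.rpow_nonneg ENNReal.toReal_nonneg _,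
          ← Fintype.prod_ite_mem I, ← Finset.prod_mul_distrib]
        refine Finset.prod_congr rfl fun j _ => ?_
        by_cases hj : j ∈ I
        · have htop : P (D j ω) / P (B j) ≠ ∞ :=
            ENNReal.div_ne_top (measure_ne_top _ _) (hBpos j).ne'
          simp only [hC, hj, if_true]
          rw [← ENNReal.ofReal_rpow_of_pos (hpos j hj), ENNReal.ofReal_toReal htop,
            ← ENNReal.mul_rpow_of_ne_top (measure_ne_top _ _) htop,
            ENNReal.mul_div_cancel (hBpos j).ne' (measure_ne_top _ _)]
        · simp [hC, hj, hP]
    calc ∫⁻ z, t ^ fsets s A z ∂Measure.pi μ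
        = ∫⁻ ω, ∫⁻ z, t ^ fsets s A (Fin.cons ω z : ∀ i, Ω i) ∂P ∂μ 0 := by
          rw [← hmp.lintegral_comp .of_discrete,
            lintegral_prod _ Measurable.of_discrete.aemeasurable]
      _ ≤ ∫⁻ ω, (∏ j, P (B j) ^ (-α)) *
          ENNReal.ofReal (1 + α * ∑ j, (1 - (P (D j ω) / P (B j)).toReal)) ∂μ 0 :=
        lintegral_mono hstep
      _ = _ := lintegral_const_mul _ .of_discrete
      _ ≤ ∏ j, (∫⁻ ω, P (D j ω) ∂μ 0) ^ (-α) :=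
        lintegral_one_add_mul_sum_le (μ 0) hα0 hDB (fun j => measure_ne_top _ _)
          fun j => (hPA j).symm ▸ (hA j).ne'
      _ = _ := by simp only [hPA]

/-- The bound of `lintegral_pow_fsets_le` in terms of the root `t` itself. -/
lemma lintegral_ofReal_pow_fsets_le {q s : ℕ} (hs : 1 ≤ s) (hsq : s < q) {α t : ℝ}
    (hα : 1 / (s : ℝ) ≤ α) (ht : 1 < t) (hE : t + α * q * t ^ (-(1 / (α * s))) = α * q + 1)
    {N : ℕ} {Ω : Fin N → Type*} [∀ i, Countable (Ω i)]
    [∀ i, MeasurableSpace (Ω i)] [∀ i, MeasurableSingletonClass (Ω i)]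
    (μ : ∀ i, Measure (Ω i)) [∀ i, IsProbabilityMeasure (μ i)]
    (A : Fin q → Set (∀ i, Ω i)) (hA : ∀ j, 0 < Measure.pi μ (A j)) :
    ∫⁻ z, ENNReal.ofReal t ^ fsets s A z ∂Measure.pi μ ≤ ∏ j, Measure.pi μ (A j) ^ (-α) := by
  have hs0 : (0 : ℝ) < s := by exact_mod_cast hs
  have hαs : 1 ≤ α * s := (div_le_iff₀ hs0).1 hα
  have hβ : 0 < α * s := by linarith
  have hlog := Real.log_pos ht
  have hexp : Real.exp (α * s * (Real.log t / (α * s))) = t := by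
    rw [mul_div_cancel₀ _ hβ.ne', Real.exp_log (by linarith)]
  have h := lintegral_pow_fsets_le hs hsq hαs (div_pos hlog hβ) ?_ μ A hA
  · rwa [hexp] at h
  · rw [Real.rpow_def_of_pos (by linarith)] at hE
    rw [hexp, show -(Real.log t / (α * s)) = Real.log t * -(1 / (α * s)) by ring]
    linarith

theorem talagrand_control_by_q_points
    {N : ℕ} {Ω : Fin N → Type*} [∀ i, Countable (Ω i)]
    [∀ i, MeasurableSpace (Ω i)] [∀ i, MeasurableSingletonClass (Ω i)]
    (μ : ∀ i, Measure (Ω i)) [∀ i, IsProbabilityMeasure (μ i)]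
    (q s : ℕ) (hq : 2 ≤ q) (hs : 1 ≤ s) (hsq : s < q)
    (α : ℝ) (hα : 1 / (s : ℝ) ≤ α) :
    (∀ t : ℝ, 1 < t → t + α * q * t ^ (-(1 / (α * s))) = α * q + 1 →
      ∀ A : Fin q → Set (∀ i, Ω i), (∀ j, 0 < Measure.pi μ (A j)) →
        (∫⁻ x, (ENNReal.ofReal t) ^ (fsets s A x) ∂(Measure.pi μ)) ≤
          ∏ j : Fin q, (Measure.pi μ (A j)) ^ (-α)) ∧
    (∀ A : Set (∀ i, Ω i), 0 < Measure.pi μ A → ∀ k : ℕ,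
      Measure.pi μ {x | k ≤ fsets s (fun _ : Fin q => A) x} ≤
        ENNReal.ofReal ((q : ℝ) / s) ^ (-(k : ℝ)) *
          (Measure.pi μ A) ^ (-((q : ℝ) / s))) := by
  have hs0 : (0 : ℝ) < s := by exact_mod_cast hs
  refine ⟨fun t ht hE A hA => lintegral_ofReal_pow_fsets_le hs hsq hα ht hE μ A hA,
    fun A hA k => ?_⟩
  have ht : 1 < (q : ℝ) / s := (one_lt_div hs0).2 (by exact_mod_cast hsq)
  have hroot : (q : ℝ) / s + 1 / (s : ℝ) * q * ((q : ℝ) / s) ^ (-(1 / (1 / (s : ℝ) * s))) =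
      1 / (s : ℝ) * q + 1 := by
    have hq0 : (0 : ℝ) < q := by positivity
    rw [one_div_mul_cancel hs0.ne', div_one, Real.rpow_neg_one]
    field_simp
  have h := lintegral_ofReal_pow_fsets_le hs hsq le_rfl ht hroot μ (fun _ => A) fun _ => hA
  have hprod : ∏ _j : Fin q, Measure.pi μ A ^ (-(1 / (s : ℝ))) =
      Measure.pi μ A ^ (-((q : ℝ) / s)) := by
    rw [Finset.prod_const, Finset.card_univ, Fintype.card_fin, ← ENNReal.rpow_mul_natCast]
    congr 1
    ring
  rw [hprod] at h
  have hT1 : 1 ≤ ENNReal.ofReal ((q : ℝ) / s) := ENNReal.one_le_ofReal.2 ht.le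
  have hTk0 : ENNReal.ofReal ((q : ℝ) / s) ^ k ≠ 0 :=
    pow_ne_zero _ (zero_lt_one.trans_le hT1).ne'
  have hTk : ENNReal.ofReal ((q : ℝ) / s) ^ k ≠ ∞ := ENNReal.pow_ne_top ENNReal.ofReal_ne_top
  rw [ENNReal.rpow_neg, ENNReal.rpow_natCast, mul_comm, ← div_eq_mul_inv,
    ENNReal.le_div_iff_mul_le (Or.inl hTk0) (Or.inl hTk), mul_comm]
  refine le_trans ?_ h
  refine le_trans ?_ (mul_meas_ge_le_lintegral .of_discrete (ENNReal.ofReal ((q : ℝ) / s) ^ k))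
  gcongr with x
  exact fun hx => pow_le_pow_right₀ hT1 hx
end

section
/- Let q ≥ 2 and 1 ≤ s < q be integers, let α ≥ 1/s be real, and let t(α,q,s) be the larger root of t + αq·t^{−1/(αs)} = αq + 1. Then for all real numbers x_1,…,x_q ∈ [0,1]: min( t(α,q,s), min_{1≤i_1<⋯<i_s≤q} (x_{i_1}·x_{i_2}⋯x_{i_s})^{−α} ) + α·∑_{i=1}^q x_i ≤ αq + 1, where by convention 0^{−α} = +∞. Moreover, t(α,q,s) is the largest value of t for which this inequality holds for all x_1,…,x_q ∈ [0,1]. -/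
open Finset
open scoped ENNReal

theorem strictConvexOn_rpow_neg {p : ℝ} (hp : 0 < p) :
    StrictConvexOn ℝ (Set.Ioi 0) fun x : ℝ => x ^ (-p) := by
  refine StrictMonoOn.strictConvexOn_of_deriv (convex_Ioi 0) ?_ ?_
  · exact fun x hx => (Real.continuousAt_rpow_const x _ (Or.inl (ne_of_gt hx))).continuousWithinAt
  · rw [interior_Ioi]
    intro x hx y hy hxy
    have hx0 : 0 < x := hx
    have hy0 : 0 < y := hy
    rw [Real.deriv_rpow_const, Real.deriv_rpow_const]
    have := Real.rpow_lt_rpow_of_neg hx0 hxy (show -p - 1 < 0 by linarith)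
    nlinarith

theorem strictConvexOn_add_mul_rpow_neg {p c : ℝ} (hp : 0 < p) (hc : 0 < c) :
    StrictConvexOn ℝ (Set.Ioi 0) fun x : ℝ => x + c * x ^ (-p) := by
  refine ⟨convex_Ioi 0, fun x hx y hy hxy a b ha hb hab => ?_⟩
  have := mul_lt_mul_of_pos_left ((strictConvexOn_rpow_neg hp).2 hx hy hxy ha hb hab) hc
  simp only [smul_eq_mul] at this ⊢
  linarith

theorem add_mul_rpow_neg_lt_max {p c x y z : ℝ} (hp : 0 < p) (hc : 0 < c) (hx : 0 < x)
    (hxy : x < y) (hyz : y < z) :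
    y + c * y ^ (-p) < max (x + c * x ^ (-p)) (z + c * z ^ (-p)) := by
  refine (strictConvexOn_add_mul_rpow_neg hp hc).lt_on_openSegment (Set.mem_Ioi.2 hx)
    (Set.mem_Ioi.2 (hx.trans (hxy.trans hyz))) (hxy.trans hyz).ne ?_
  rw [openSegment_eq_Ioo (hxy.trans hyz)]
  exact ⟨hxy, hyz⟩

/-- The AM-GM inequality for the numbers `v / y i`, when the `y i` have product at most `v ^ #I`. -/
theorem card_le_sum_div_of_prod_le_pow {ι : Type*} (I : Finset ι) (y : ι → ℝ) (v : ℝ)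
    (hv : 0 < v) (hy : ∀ i ∈ I, 0 < y i) (hprod : ∏ i ∈ I, y i ≤ v ^ #I) :
    (#I : ℝ) ≤ ∑ i ∈ I, v / y i := by
  have hlog : 0 ≤ ∑ i ∈ I, Real.log (v / y i) := by
    rw [← Real.log_prod fun i hi => (div_pos hv (hy i hi)).ne']
    refine Real.log_nonneg ?_
    rw [prod_div_distrib, prod_const, one_le_div (prod_pos hy)]
    exact hprod
  have hle : ∑ i ∈ I, (Real.log (v / y i) + 1) ≤ ∑ i ∈ I, v / y i :=
    sum_le_sum fun i hi => by
      linarith [Real.log_le_sub_one_of_pos (div_pos hv (hy i hi))]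
  rw [sum_add_distrib, sum_const, nsmul_eq_mul, mul_one] at hle
  linarith

theorem sum_le_of_prod_le_pow {ι : Type*} (I : Finset ι) (y : ι → ℝ) (v m : ℝ)
    (hv : 0 < v) (hm : 0 ≤ m) (hmy : ∀ i ∈ I, m ≤ y i) (hy1 : ∀ i ∈ I, y i ≤ 1)
    (hprod : ∏ i ∈ I, y i ≤ v ^ #I) :
    ∑ i ∈ I, y i ≤ #I * (1 + m - m / v) := by
  rcases hm.eq_or_lt with rfl | hm
  · simpa using sum_le_sum hy1
  have hpos : ∀ i ∈ I, 0 < y i := fun i hi => hm.trans_le (hmy i hi)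
  have key : ∀ i ∈ I, y i ≤ (1 + m) - m / v * (v / y i) := by
    intro i hi
    have h0 := hpos i hi
    have : m / v * (v / y i) = m / y i := by field_simp
    rw [this, le_sub_iff_add_le, ← le_sub_iff_add_le', div_le_iff₀ h0]
    nlinarith [mul_nonneg (sub_nonneg.2 (hy1 i hi)) (sub_nonneg.2 (hmy i hi))]
  have h1 := sum_le_sum key
  rw [sum_sub_distrib, sum_const, nsmul_eq_mul, ← mul_sum] at h1
  have h2 := mul_le_mul_of_nonneg_left
    (card_le_sum_div_of_prod_le_pow I y v hv hpos hprod) (div_pos hm hv).le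
  linarith

theorem exists_powersetCard_top {q s : ℕ} (hs : 1 ≤ s) (hsq : s < q) (x : Fin q → ℝ) :
    ∃ I ∈ powersetCard s (univ : Finset (Fin q)), ∃ k, (∀ i ∈ I, x k ≤ x i) ∧
      ∀ i ∉ I, x i ≤ x k := by
  set σ := Tuple.sort x
  have hmono : Monotone (x ∘ σ) := Tuple.monotone_sort x
  let a : Fin q := ⟨q - s, by omega⟩
  refine ⟨(Ici a).map σ.toEmbedding, ?_, σ a, ?_, ?_⟩
  · rw [mem_powersetCard]
    refine ⟨subset_univ _, ?_⟩
    rw [card_map, Fin.card_Ici]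
    simp only [a]
    omega
  · intro i hi
    obtain ⟨j, hj, rfl⟩ := mem_map.1 hi
    exact hmono (mem_Ici.1 hj)
  · intro i hi
    have hlt : σ.symm i ≤ a := by
      by_contra! h
      exact hi (mem_map.2 ⟨σ.symm i, mem_Ici.2 h.le, by simp⟩)
    simpa using hmono hlt

/-- If the `s` largest among `q` numbers in `[0, 1]` have product at most `v ^ s`, where
`s / q ≤ v ≤ 1`, then the sum of all of them is at most `q * v`. -/
theorem sum_le_mul_of_top_prod_le_pow {q s : ℕ} (hsq : s < q) (x : Fin q → ℝ)
    (hx : ∀ i, x i ∈ Set.Icc (0 : ℝ) 1) (I : Finset (Fin q)) (hI : #I = s) (k : Fin q)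
    (hmem : ∀ i ∈ I, x k ≤ x i) (hnot : ∀ i ∉ I, x i ≤ x k) {v : ℝ} (hv : 0 < v)
    (hqv : s ≤ q * v) (hs : 1 ≤ s) (hprod : ∏ i ∈ I, x i ≤ v ^ s) :
    ∑ i, x i ≤ q * v := by
  subst hI
  have h1 := sum_le_of_prod_le_pow I x v (x k) hv (hx k).1 hmem (fun i _ => (hx i).2) hprod
  have h2 : ∑ i ∈ Iᶜ, x i ≤ (q - #I : ℝ) * x k := by
    have := sum_le_card_nsmul Iᶜ x (x k) fun i hi => hnot i (mem_compl.1 hi)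
    rw [card_compl, Fintype.card_fin, nsmul_eq_mul, Nat.cast_sub hsq.le] at this
    exact this
  have hkv : x k ≤ v := by
    have h3 : x k ^ #I ≤ ∏ i ∈ I, x i := by
      rw [← prod_const]
      exact prod_le_prod (fun _ _ => (hx k).1) hmem
    exact le_of_pow_le_pow_left₀ (by omega) hv.le (h3.trans hprod)
  have h4 : (#I : ℝ) / v ≤ q := by rwa [div_le_iff₀ hv]
  have h5 := mul_nonneg (sub_nonneg.2 h4) (sub_nonneg.2 hkv)
  have h6 : ((q : ℝ) - #I / v) * (v - x k) = q * v - q * x k - #I * (1 - x k / v) := by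
    field_simp
  rw [← sum_add_sum_compl I x]
  linarith

theorem rpow_neg_pow_rpow_neg {α τ : ℝ} {s : ℕ} (hα : 0 < α) (hs : 1 ≤ s) (hτ : 0 < τ) :
    ((τ ^ (-(1 / (α * s)))) ^ s) ^ (-α) = τ := by
  have hs0 : (0 : ℝ) < s := by exact_mod_cast hs
  rw [← Real.rpow_natCast, ← Real.rpow_mul hτ.le, ← Real.rpow_mul hτ.le]
  have : -(1 / (α * s)) * s * -α = 1 := by field_simp
  rw [this, Real.rpow_one]

theorem div_le_rpow_of_larger_root {q s : ℕ} (hs : 1 ≤ s) (hsq : s < q) {α t : ℝ}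
    (hα : 1 / (s : ℝ) ≤ α) (ht1 : 1 < t)
    (ht : t + α * q * t ^ (-(1 / (α * s))) = α * q + 1) :
    (s : ℝ) ≤ q * t ^ (-(1 / (α * s))) := by
  have hs0 : (0 : ℝ) < s := by exact_mod_cast hs
  have hsq' : (s : ℝ) < q := by exact_mod_cast hsq
  have hα0 : 0 < α := (one_div_pos.2 hs0).trans_le hα
  have hαs : 1 ≤ α * s := by rwa [div_le_iff₀ hs0] at hα
  have hp : 0 < 1 / (α * s) := by positivity
  have hc : 0 < α * q := by nlinarith
  have hr : 1 < (q : ℝ) / s := by rwa [one_lt_div hs0]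
  set T : ℝ := ((q : ℝ) / s) ^ (α * s) with hT
  have hT1 : 1 < T := Real.one_lt_rpow hr (by linarith)
  have hTp : T ^ (-(1 / (α * s))) = s / q := by
    rw [hT, ← Real.rpow_mul (by positivity)]
    have : α * s * -(1 / (α * s)) = -1 := by field_simp
    rw [this, Real.rpow_neg_one, inv_div]
  have hbern := one_add_mul_self_le_rpow_one_add (s := (q : ℝ) / s - 1) (by linarith) hαs
  have hTt : t ≤ T := by
    by_contra! hlt
    have := add_mul_rpow_neg_lt_max hp hc one_pos hT1 hlt
    rw [ht, hTp, Real.one_rpow, mul_one, add_comm 1, max_self] at this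
    rw [add_sub_cancel] at hbern
    have e1 : α * s * ((q : ℝ) / s - 1) = α * q - α * s := by field_simp
    have e2 : α * q * ((s : ℝ) / q) = α * s := by
      have : (q : ℝ) ≠ 0 := by linarith
      field_simp
    linarith
  have := Real.rpow_le_rpow_of_nonpos (by linarith) hTt (neg_nonpos.2 hp.le)
  rw [hTp, div_le_iff₀ (by linarith)] at this
  linarith

/-- The real-valued form of the inequality, with `τ` a lower bound for the minimum. -/
theorem add_mul_sum_le_of_prod_le {q s : ℕ} (hs : 1 ≤ s) (hsq : s < q) {α t τ : ℝ}
    (hα : 1 / (s : ℝ) ≤ α) (ht1 : 1 < t)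
    (ht : t + α * q * t ^ (-(1 / (α * s))) = α * q + 1) (hτ1 : 1 ≤ τ) (hτt : τ ≤ t)
    (x : Fin q → ℝ) (hx : ∀ i, x i ∈ Set.Icc (0 : ℝ) 1) (I : Finset (Fin q)) (hI : #I = s)
    (k : Fin q) (hmem : ∀ i ∈ I, x k ≤ x i) (hnot : ∀ i ∉ I, x i ≤ x k)
    (hprod : 0 < ∏ i ∈ I, x i → τ ≤ (∏ i ∈ I, x i) ^ (-α)) :
    τ + α * ∑ i, x i ≤ α * q + 1 := by
  have hs0 : (0 : ℝ) < s := by exact_mod_cast hs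
  have hsq' : (s : ℝ) < q := by exact_mod_cast hsq
  have hα0 : 0 < α := (one_div_pos.2 hs0).trans_le hα
  have hp : 0 < 1 / (α * s) := by positivity
  have hc : 0 < α * q := by nlinarith
  have hτ0 : 0 < τ := by linarith
  have hv : 0 < τ ^ (-(1 / (α * s))) := Real.rpow_pos_of_pos hτ0 _
  have hle : τ + α * q * τ ^ (-(1 / (α * s))) ≤ α * q + 1 := by
    rcases hτ1.eq_or_lt with rfl | hτ1
    · simp [add_comm]
    rcases hτt.eq_or_lt with rfl | hτt
    · exact ht.le
    have := add_mul_rpow_neg_lt_max hp hc one_pos hτ1 hτt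
    rw [ht, Real.one_rpow, mul_one, add_comm 1, max_self] at this
    exact this.le
  have hqv : (s : ℝ) ≤ q * τ ^ (-(1 / (α * s))) :=
    (div_le_rpow_of_larger_root hs hsq hα ht1 ht).trans <|
      mul_le_mul_of_nonneg_left
        (Real.rpow_le_rpow_of_nonpos hτ0 hτt (neg_nonpos.2 hp.le)) (by positivity)
  have hP : ∏ i ∈ I, x i ≤ (τ ^ (-(1 / (α * s)))) ^ s := by
    by_contra! hlt
    have hpos : 0 < (τ ^ (-(1 / (α * s)))) ^ s := by positivity
    have h1 := hprod (hpos.trans hlt)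
    have h2 := Real.rpow_lt_rpow_of_neg hpos hlt (neg_neg_of_pos hα0)
    rw [rpow_neg_pow_rpow_neg hα0 hs hτ0] at h2
    linarith
  have := mul_le_mul_of_nonneg_left
    (sum_le_mul_of_top_prod_le_pow hsq x hx I hI k hmem hnot hv hqv hs hP) hα0.le
  linarith

theorem min_control_inequality (q s : ℕ) (hq : 2 ≤ q) (hs : 1 ≤ s) (hsq : s < q)
    (α : ℝ) (hα : 1 / (s : ℝ) ≤ α)
    (t : ℝ) (ht1 : 1 < t)
    (ht : t + α * q * t ^ (-(1 / (α * s))) = α * q + 1) :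
    (∀ x : Fin q → ℝ, (∀ i, x i ∈ Set.Icc (0 : ℝ) 1) →
      min (ENNReal.ofReal t)
          (⨅ I ∈ Finset.powersetCard s (Finset.univ : Finset (Fin q)),
            ENNReal.ofReal (∏ i ∈ I, x i) ^ (-α))
        + ENNReal.ofReal (α * ∑ i, x i) ≤ ENNReal.ofReal (α * q + 1)) ∧
    ∀ t' : ℝ,
      (∀ x : Fin q → ℝ, (∀ i, x i ∈ Set.Icc (0 : ℝ) 1) →
        min (ENNReal.ofReal t')
            (⨅ I ∈ Finset.powersetCard s (Finset.univ : Finset (Fin q)),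
              ENNReal.ofReal (∏ i ∈ I, x i) ^ (-α))
          + ENNReal.ofReal (α * ∑ i, x i) ≤ ENNReal.ofReal (α * q + 1)) →
      t' ≤ t := by
  have hs0 : (0 : ℝ) < s := by exact_mod_cast hs
  have hsq' : (s : ℝ) < q := by exact_mod_cast hsq
  have hα0 : 0 < α := (one_div_pos.2 hs0).trans_le hα
  have hp : 0 < 1 / (α * s) := by positivity
  have hc : 0 < α * q := by nlinarith
  refine ⟨fun x hx => ?_, fun t' h => ?_⟩
  · obtain ⟨I, hI, k, hmem, hnot⟩ := exists_powersetCard_top hs hsq x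
    have hcard := (mem_powersetCard.1 hI).2
    have hsum : 0 ≤ α * ∑ i, x i := mul_nonneg hα0.le (sum_nonneg fun i _ => (hx i).1)
    have hinf := iInf₂_le (f := fun J (_ : J ∈ powersetCard s (univ : Finset (Fin q))) =>
      ENNReal.ofReal (∏ i ∈ J, x i) ^ (-α)) I hI
    obtain ⟨τ, hτ1, hτt, hprod, hmin⟩ : ∃ τ, 1 ≤ τ ∧ τ ≤ t ∧
        (0 < ∏ i ∈ I, x i → τ ≤ (∏ i ∈ I, x i) ^ (-α)) ∧
        min (ENNReal.ofReal t) (ENNReal.ofReal (∏ i ∈ I, x i) ^ (-α)) ≤ ENNReal.ofReal τ := by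
      by_cases hP : 0 < ∏ i ∈ I, x i
      · have hP1 : ∏ i ∈ I, x i ≤ 1 := prod_le_one (fun i _ => (hx i).1) fun i _ => (hx i).2
        refine ⟨min t ((∏ i ∈ I, x i) ^ (-α)), le_min ht1.le ?_, min_le_left _ _,
          fun _ => min_le_right _ _, ?_⟩
        · exact Real.one_le_rpow_of_pos_of_le_one_of_nonpos hP hP1 (by linarith)
        · rw [ENNReal.ofReal_rpow_of_pos hP, ENNReal.ofReal_min]
      · exact ⟨t, ht1.le, le_rfl, fun h => absurd h hP, min_le_left _ _⟩
    refine (add_le_add_left ((min_le_min_left _ hinf).trans hmin) _).trans ?_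
    rw [← ENNReal.ofReal_add (by linarith) hsum]
    exact ENNReal.ofReal_le_ofReal
      (add_mul_sum_le_of_prod_le hs hsq hα ht1 ht hτ1 hτt x hx I hcard k hmem hnot hprod)
  · by_contra! hlt
    have ht'0 : 0 < t' := by linarith
    set v : ℝ := t' ^ (-(1 / (α * s))) with hv
    have hv0 : 0 < v := Real.rpow_pos_of_pos ht'0 _
    have hv1 : v ≤ 1 := Real.rpow_le_one_of_one_le_of_nonpos (by linarith) (by linarith)
    have h1 := h (fun _ => v) fun _ => ⟨hv0.le, hv1⟩
    have hle : ENNReal.ofReal t' ≤ ⨅ I ∈ powersetCard s (univ : Finset (Fin q)),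
        ENNReal.ofReal (∏ _i ∈ I, v) ^ (-α) := by
      refine le_iInf₂ fun I hI => ?_
      rw [prod_const, (mem_powersetCard.1 hI).2, ENNReal.ofReal_rpow_of_pos (by positivity), hv,
        rpow_neg_pow_rpow_neg hα0 hs ht'0]
    rw [min_eq_left hle, sum_const, card_univ, Fintype.card_fin, nsmul_eq_mul,
      ← ENNReal.ofReal_add ht'0.le (by positivity),
      ENNReal.ofReal_le_ofReal_iff (by positivity)] at h1
    have h2 := add_mul_rpow_neg_lt_max hp hc one_pos ht1 hlt
    rw [ht, Real.one_rpow, mul_one, add_comm 1, ← hv, lt_max_iff] at h2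
    rcases h2 with h2 | h2 <;> linarith
end

section
/- Let 2 ≤ q ≤ m and let H_{q−1} = ∑_{i=1}^{q−1} 1/i denote the (q−1)-st harmonic number. Then every subadditive normalized monotone valuation g over [m] is (1/H_{q−1})-close to q-partitioning: for every S ⊆ [m], every partition of S into q pairwise disjoint (possibly empty) parts S_1,…,S_q, and every fractional cover α of [q], one has ∑_{T⊆[q]} α(T)·g(⋃_{i∈T}S_i) ≥ g(S)/H_{q−1}. -/
open Finset

/-- Among the terms of `H_n`, the last `n - k` are each at least `1 / n`. -/
theorem sub_div_add_harmonic_le {k n : ℕ} (hkn : k ≤ n) :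
    ((n : ℝ) - k) / n + ∑ i ∈ range k, (1 : ℝ) / (i + 1) ≤ ∑ i ∈ range n, (1 : ℝ) / (i + 1) := by
  rw [← Finset.sum_range_add_sum_Ico _ hkn, add_comm]
  gcongr
  have h : ∀ i ∈ Ico k n, (1 : ℝ) / n ≤ 1 / (i + 1) := by
    intro i hi
    have hin : i + 1 ≤ n := (mem_Ico.mp hi).2
    apply one_div_le_one_div_of_le (by positivity)
    exact_mod_cast hin
  have h2 := Finset.card_nsmul_le_sum _ _ _ h
  rw [Nat.card_Ico, nsmul_eq_mul, Nat.cast_sub hkn, mul_one_div] at h2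
  exact h2

/-- Prices produced by the greedy set-cover algorithm restricted to proper subsets. -/
theorem exists_greedy_prices {ι : Type*} [Fintype ι] [DecidableEq ι] [Nontrivial ι]
    (f : Finset ι → ℝ) (h0 : f ∅ = 0) (hmono : ∀ S T, S ⊆ T → f S ≤ f T)
    (hsub : ∀ S T, f (S ∪ T) ≤ f S + f T) (U : Finset ι) :
    ∃ y : ι → ℝ, (∀ j, 0 ≤ y j) ∧ f U ≤ ∑ j ∈ U, y j ∧
      ∀ T ⊆ U, T ≠ univ → ∑ j ∈ T, y j ≤ f T * ∑ i ∈ range #T, (1 : ℝ) / (i + 1) := by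
  have hnonneg : ∀ S, 0 ≤ f S := fun S => h0 ▸ hmono ∅ S (empty_subset S)
  induction U using Finset.strongInduction with
  | H U ih =>
  rcases U.eq_empty_or_nonempty with rfl | ⟨u, hu⟩
  · refine ⟨0, by simp, by simp [h0], ?_⟩
    intro T hT _
    simp [subset_empty.mp hT]
  obtain ⟨A, hA, hmin⟩ := exists_min_image
    (U.powerset.filter fun T => T.Nonempty ∧ T ≠ univ) (fun T => f T / #T)
    ⟨{u}, by
      obtain ⟨v, hv⟩ := exists_ne u
      simp only [mem_filter, mem_powerset, singleton_subset_iff, singleton_nonempty]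
      exact ⟨hu, trivial, fun h => hv (mem_singleton.mp (h ▸ mem_univ v))⟩⟩
  simp only [mem_filter, mem_powerset] at hA hmin
  obtain ⟨hAU, hAne, -⟩ := hA
  obtain ⟨y, hy0, hyU, hyT⟩ := ih (U \ A) (sdiff_ssubset hAU hAne)
  have hr : 0 ≤ f A / #A := div_nonneg (hnonneg A) (Nat.cast_nonneg _)
  have hsum : ∀ T : Finset ι, ∑ j ∈ T, (if j ∈ A then f A / #A else y j) =
      #(T ∩ A) * (f A / #A) + ∑ j ∈ T \ A, y j := by
    intro T
    rw [sum_ite, sum_const, nsmul_eq_mul, filter_mem_eq_inter, filter_notMem_eq_sdiff]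
  refine ⟨fun j => if j ∈ A then f A / #A else y j, ?_, ?_, ?_⟩
  · intro j
    dsimp only
    split_ifs
    exacts [hr, hy0 j]
  · rw [hsum, inter_eq_right.mpr hAU,
      mul_div_cancel₀ _ (Nat.cast_ne_zero.mpr hAne.card_pos.ne')]
    have h := hsub A (U \ A)
    rw [union_sdiff_of_subset hAU] at h
    linarith
  · intro T hTU hT
    rcases T.eq_empty_or_nonempty with rfl | hTne
    · simp
    rw [hsum]
    have hTA : T \ A ≠ univ := fun h => hT (univ_subset_iff.mp (h ▸ sdiff_subset))
    have hrest := hyT (T \ A) (sdiff_subset_sdiff hTU subset_rfl) hTA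
    have hH : 0 ≤ ∑ i ∈ range #(T \ A), (1 : ℝ) / (i + 1) := sum_nonneg fun i _ => by positivity
    have hcard : (#(T ∩ A) : ℝ) = #T - #(T \ A) := by
      rw [eq_sub_iff_add_eq]
      exact_mod_cast card_inter_add_card_sdiff T A
    calc (#(T ∩ A) : ℝ) * (f A / #A) + ∑ j ∈ T \ A, y j
        ≤ #(T ∩ A) * (f T / #T) + f T * ∑ i ∈ range #(T \ A), (1 : ℝ) / (i + 1) := by
          exact add_le_add
            (mul_le_mul_of_nonneg_left (hmin T ⟨hTU, hTne, hT⟩) (Nat.cast_nonneg _))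
            (hrest.trans (mul_le_mul_of_nonneg_right (hmono _ _ sdiff_subset) hH))
      _ = f T * (((#T : ℝ) - #(T \ A)) / #T + ∑ i ∈ range #(T \ A), (1 : ℝ) / (i + 1)) := by
          rw [hcard]; ring
      _ ≤ f T * ∑ i ∈ range #T, (1 : ℝ) / (i + 1) :=
          mul_le_mul_of_nonneg_left (sub_div_add_harmonic_le (card_le_card sdiff_subset))
            (hnonneg T)

/-- A cost allocation of `f univ` that overcharges each set by at most `H_{|ι| - 1}`. -/
theorem exists_harmonic_allocation {ι : Type*} [Fintype ι] [DecidableEq ι] [Nontrivial ι]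
    (f : Finset ι → ℝ) (h0 : f ∅ = 0) (hmono : ∀ S T, S ⊆ T → f S ≤ f T)
    (hsub : ∀ S T, f (S ∪ T) ≤ f S + f T) :
    ∃ z : ι → ℝ, (∀ j, 0 ≤ z j) ∧ ∑ j, z j = f univ ∧
      ∀ T, ∑ j ∈ T, z j ≤ f T * ∑ i ∈ range (Fintype.card ι - 1), (1 : ℝ) / (i + 1) := by
  have hnonneg : ∀ S, 0 ≤ f S := fun S => h0 ▸ hmono ∅ S (empty_subset S)
  obtain ⟨y, hy0, hyU, hyT⟩ := exists_greedy_prices f h0 hmono hsub univ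
  have hY : 0 ≤ ∑ j, y j := sum_nonneg fun j _ => hy0 j
  have hc0 : 0 ≤ f univ / ∑ j, y j := div_nonneg (hnonneg _) hY
  have hc1 : f univ / ∑ j, y j ≤ 1 := div_le_one_of_le₀ hyU hY
  have htotal : ∑ j, f univ / (∑ j, y j) * y j = f univ := by
    rw [← mul_sum]
    apply div_mul_cancel_of_imp
    intro h
    exact le_antisymm (h ▸ hyU) (hnonneg _)
  have hmonoH : ∀ {a b : ℕ}, a ≤ b →
      ∑ i ∈ range a, (1 : ℝ) / (i + 1) ≤ ∑ i ∈ range b, (1 : ℝ) / (i + 1) := fun hab =>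
    sum_le_sum_of_subset_of_nonneg (range_mono hab) fun i _ _ => by positivity
  refine ⟨fun j => f univ / (∑ j, y j) * y j, fun j => mul_nonneg hc0 (hy0 j), htotal, ?_⟩
  intro T
  by_cases hT : T = univ
  · subst hT
    rw [htotal]
    apply le_mul_of_one_le_right (hnonneg _)
    have h := hmonoH (Nat.le_sub_one_of_lt (Fintype.one_lt_card (α := ι)))
    simpa using h
  · rw [← mul_sum]
    calc f univ / (∑ j, y j) * ∑ j ∈ T, y j ≤ ∑ j ∈ T, y j :=
          mul_le_of_le_one_left (sum_nonneg fun j _ => hy0 j) hc1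
      _ ≤ f T * ∑ i ∈ range #T, (1 : ℝ) / (i + 1) := hyT T (subset_univ T) hT
      _ ≤ _ := mul_le_mul_of_nonneg_left
          (hmonoH (Nat.le_sub_one_of_lt ((card_lt_iff_ne_univ T).mpr hT))) (hnonneg T)

theorem subadditive_harmonic_close (m q : ℕ) (hq : 2 ≤ q) (hqm : q ≤ m)
    (g : Finset (Fin m) → ℝ) (hg : IsValuation m g)
    (hsub : ∀ S T : Finset (Fin m), g (S ∪ T) ≤ g S + g T)
    (S : Finset (Fin m)) (P : Fin q → Finset (Fin m)) (hP : IsPartitionInto m q S P)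
    (α : Finset (Fin q) → ℝ) (hα : IsFractionalCover q α) :
    g S / (∑ i ∈ Finset.range (q - 1), (1 : ℝ) / (i + 1)) ≤
      ∑ T : Finset (Fin q), α T * g (T.biUnion P) := by
  have : Nontrivial (Fin q) := Fin.nontrivial_iff_two_le.mpr hq
  obtain ⟨z, hz0, hzU, hzT⟩ := exists_harmonic_allocation (fun T : Finset (Fin q) => g (T.biUnion P))
    (by simpa using hg.1) (fun A B h => hg.2.1 _ _ (biUnion_subset_biUnion_of_subset_left P h))
    (fun A B => by simpa only [union_biUnion] using hsub (A.biUnion P) (B.biUnion P))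
  simp only [hP.2, Fintype.card_fin] at hzU hzT
  have hH : 0 < ∑ i ∈ range (q - 1), (1 : ℝ) / (i + 1) :=
    sum_pos (fun i _ => by positivity) (nonempty_range_iff.mpr (by omega))
  rw [div_le_iff₀ hH, sum_mul, ← hzU]
  calc ∑ j, z j ≤ ∑ j, (∑ T ∈ univ.filter (fun T : Finset (Fin q) => j ∈ T), α T) * z j :=
        sum_le_sum fun j _ => le_mul_of_one_le_left (hz0 j) (hα.2 j)
    _ = ∑ T, α T * ∑ j ∈ T, z j := by
        simp only [sum_mul, mul_sum]
        exact sum_comm' (by simp)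
    _ ≤ _ := sum_le_sum fun T _ => by
        rw [mul_assoc]
        exact mul_le_mul_of_nonneg_left (hzT T) (hα.1 T)
end

section
/- For any integers 2 < q ≤ m, there exists a subadditive normalized monotone valuation g over [m] that is not γ-close to the class of q-partitioning valuations for any γ > 2/log₂(q/2): there exist a set S ⊆ [m], a partition of S into q pairwise disjoint parts S_1,…,S_q, and a fractional cover α of [q] such that ∑_{T⊆[q]} α(T)·g(⋃_{i∈T}S_i) ≤ (2/log₂(q/2))·g(S). -/
open Finset

/-- The least number of vectors `w` such that every item of `S` has a label not orthogonal to
one of them. -/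
noncomputable def coverNumber {m k : ℕ} (φ : Fin m → Fin k → ZMod 2) (S : Finset (Fin m)) : ℕ :=
  sInf {n | ∃ W : Finset (Fin k → ZMod 2), #W = n ∧ ∀ i ∈ S, ∃ w ∈ W, w ⬝ᵥ φ i ≠ 0}

lemma coverNumber_le {m k : ℕ} {φ : Fin m → Fin k → ZMod 2} {S : Finset (Fin m)}
    (W : Finset (Fin k → ZMod 2)) (hW : ∀ i ∈ S, ∃ w ∈ W, w ⬝ᵥ φ i ≠ 0) :
    coverNumber φ S ≤ #W :=
  Nat.sInf_le ⟨W, rfl, hW⟩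

lemma exists_card_eq_coverNumber {m k : ℕ} {φ : Fin m → Fin k → ZMod 2} (hφ : ∀ i, φ i ≠ 0)
    (S : Finset (Fin m)) :
    ∃ W : Finset (Fin k → ZMod 2), #W = coverNumber φ S ∧ ∀ i ∈ S, ∃ w ∈ W, w ⬝ᵥ φ i ≠ 0 := by
  refine Nat.sInf_mem (s := {n | ∃ W : Finset (Fin k → ZMod 2), #W = n ∧
    ∀ i ∈ S, ∃ w ∈ W, w ⬝ᵥ φ i ≠ 0}) ⟨_, univ, rfl, fun i _ => ?_⟩
  obtain ⟨j, hj⟩ := Function.ne_iff.mp (hφ i)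
  exact ⟨Pi.single j 1, mem_univ _, by simpa using hj⟩

lemma coverNumber_empty {m k : ℕ} (φ : Fin m → Fin k → ZMod 2) : coverNumber φ ∅ = 0 := by
  simpa using coverNumber_le (φ := φ) (S := ∅) ∅ (by simp)

lemma coverNumber_mono {m k : ℕ} {φ : Fin m → Fin k → ZMod 2} (hφ : ∀ i, φ i ≠ 0)
    {S T : Finset (Fin m)} (h : S ⊆ T) : coverNumber φ S ≤ coverNumber φ T := by
  obtain ⟨W, hc, hW⟩ := exists_card_eq_coverNumber hφ T
  exact hc ▸ coverNumber_le W fun i hi => hW i (h hi)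

lemma coverNumber_union_le {m k : ℕ} {φ : Fin m → Fin k → ZMod 2} (hφ : ∀ i, φ i ≠ 0)
    (S T : Finset (Fin m)) : coverNumber φ (S ∪ T) ≤ coverNumber φ S + coverNumber φ T := by
  obtain ⟨W, hc, hW⟩ := exists_card_eq_coverNumber hφ S
  obtain ⟨X, hd, hX⟩ := exists_card_eq_coverNumber hφ T
  rw [← hc, ← hd]
  refine (coverNumber_le (W ∪ X) fun i hi => ?_).trans (card_union_le W X)
  rcases mem_union.mp hi with hi | hi
  · obtain ⟨w, hw, h⟩ := hW i hi
    exact ⟨w, mem_union_left _ hw, h⟩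
  · obtain ⟨w, hw, h⟩ := hX i hi
    exact ⟨w, mem_union_right _ hw, h⟩

lemma exists_ne_zero_forall_dotProduct_eq_zero {k : ℕ} (W : Finset (Fin k → ZMod 2))
    (hW : #W < k) : ∃ u : Fin k → ZMod 2, u ≠ 0 ∧ ∀ w ∈ W, w ⬝ᵥ u = 0 := by
  let A : Matrix W (Fin k) (ZMod 2) := Matrix.of fun w => w.1
  have hker : LinearMap.ker A.mulVecLin ≠ ⊥ :=
    LinearMap.ker_ne_bot_of_finrank_lt (by simpa using hW)
  obtain ⟨u, hu, hu0⟩ := (Submodule.ne_bot_iff _).mp hker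
  exact ⟨u, hu0, fun w hw => congrFun (LinearMap.mem_ker.mp hu) ⟨w, hw⟩⟩

lemma le_coverNumber {m k : ℕ} {φ : Fin m → Fin k → ZMod 2} (hφ : ∀ i, φ i ≠ 0)
    {S : Finset (Fin m)} (hS : ∀ u, u ≠ 0 → ∃ i ∈ S, φ i = u) : k ≤ coverNumber φ S := by
  obtain ⟨W, hc, hW⟩ := exists_card_eq_coverNumber hφ S
  by_contra! hlt
  obtain ⟨u, hu0, hu⟩ := exists_ne_zero_forall_dotProduct_eq_zero W (hc ▸ hlt)
  obtain ⟨i, hi, rfl⟩ := hS u hu0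
  obtain ⟨w, hw, h⟩ := hW i hi
  exact h (hu w hw)

lemma two_mul_card_dotProduct_ne_zero {k : ℕ} {u : Fin k → ZMod 2} (hu : u ≠ 0) :
    2 * #{w : Fin k → ZMod 2 | w ⬝ᵥ u ≠ 0} = 2 ^ k := by
  obtain ⟨j, hj⟩ := Function.ne_iff.mp hu
  have hj1 : u j = 1 := by
    have : ∀ x : ZMod 2, x ≠ 0 → x = 1 := by decide
    exact this _ hj
  have hflip : ∀ x : ZMod 2, x + 1 = 0 ↔ x ≠ 0 := by decide
  have hcard : #{w : Fin k → ZMod 2 | w ⬝ᵥ u ≠ 0} = #{w : Fin k → ZMod 2 | ¬ w ⬝ᵥ u ≠ 0} := by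
    refine card_equiv (Equiv.addRight (Pi.single j 1)) fun w => ?_
    simp [add_dotProduct, hj1, hflip]
  have htot := card_filter_add_card_filter_not (s := (univ : Finset (Fin k → ZMod 2)))
    (fun w => w ⬝ᵥ u ≠ 0)
  have huniv : #(univ : Finset (Fin k → ZMod 2)) = 2 ^ k := by simp [ZMod.card]
  omega

/-- Labels of the items by nonzero vectors, all of which occur among the first `q` items. -/
lemma exists_labelling {m q k : ℕ} (hk : 0 < k) (hkq : 2 ^ k ≤ q) (hqm : q ≤ m) :
    ∃ φ : Fin m → Fin k → ZMod 2, (∀ i, φ i ≠ 0) ∧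
      ∀ u, u ≠ 0 → ∃ i : Fin q, φ (Fin.castLE hqm i) = u := by
  have : Nonempty {u : Fin k → ZMod 2 // u ≠ 0} :=
    ⟨⟨Pi.single ⟨0, hk⟩ 1, by simp⟩⟩
  have hcard : Fintype.card {u : Fin k → ZMod 2 // u ≠ 0} ≤ Fintype.card (Fin q) := by
    refine (Fintype.card_subtype_le _).trans ?_
    simpa [ZMod.card] using hkq
  obtain ⟨f⟩ := Function.Embedding.nonempty_of_card_le hcard
  let f' : {u : Fin k → ZMod 2 // u ≠ 0} → Fin m := Fin.castLE hqm ∘ f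
  have hf' : Function.Injective f' := (Fin.castLE_injective hqm).comp f.injective
  exact ⟨fun i => (Function.invFun f' i).1, fun i => (Function.invFun f' i).2, fun u hu =>
    ⟨f ⟨u, hu⟩, congrArg Subtype.val (Function.leftInverse_invFun hf' ⟨u, hu⟩)⟩⟩

/-- Integrating `f` against the pushforward along `t` of the measure giving mass `c` to each point. -/
lemma sum_pushforward_const_mul {ι κ : Type*} [Fintype ι] [Fintype κ] [DecidableEq κ] (t : ι → κ)
    (c : ℝ) (f : κ → ℝ) :
    ∑ T, (∑ w, if t w = T then c else 0) * f T = ∑ w, c * f (t w) := by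
  simp_rw [sum_mul]
  rw [sum_comm]
  simp [ite_mul]

theorem subadditive_far_from_qPartitioning (m q : ℕ) (hq : 2 < q) (hqm : q ≤ m) :
    ∃ g : Finset (Fin m) → ℝ, IsValuation m g ∧
      (∀ S T : Finset (Fin m), g (S ∪ T) ≤ g S + g T) ∧
      ∀ γ : ℝ, 2 / Real.logb 2 ((q : ℝ) / 2) < γ →
        ¬ (∀ S P, IsPartitionInto m q S P → ∀ α, IsFractionalCover q α →
            γ * g S ≤ ∑ T : Finset (Fin q), α T * g (T.biUnion P)) := by
  obtain ⟨k, hk⟩ : ∃ k, k = Nat.log 2 q := ⟨_, rfl⟩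
  have hk0 : 0 < k := hk ▸ Nat.log_pos one_lt_two hq.le
  have hkq : 2 ^ k ≤ q := hk ▸ Nat.pow_log_le_self 2 (by omega)
  have hqk : q < 2 ^ (k + 1) := hk ▸ Nat.lt_pow_succ_log_self one_lt_two q
  obtain ⟨φ, hφ, hsurj⟩ := exists_labelling hk0 hkq hqm
  refine ⟨fun S => coverNumber φ S, ⟨by simp [coverNumber_empty], fun S T h => ?_, fun S => ?_⟩,
    fun S T => ?_, fun γ hγ hclose => ?_⟩
  · exact Nat.cast_le.mpr (coverNumber_mono hφ h)
  · positivity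
  · beta_reduce
    exact_mod_cast coverNumber_union_le hφ S T
  let P : Fin q → Finset (Fin m) := fun i => {Fin.castLE hqm i}
  let t : (Fin k → ZMod 2) → Finset (Fin q) :=
    fun w => {i | w ⬝ᵥ φ (Fin.castLE hqm i) ≠ 0}
  let c : ℝ := 2 / 2 ^ k
  have hP : IsPartitionInto m q (univ.biUnion P) P :=
    ⟨fun i j hij => by simpa [P] using hij, rfl⟩
  have hα : IsFractionalCover q fun T => ∑ w, if t w = T then c else 0 := by
    refine ⟨fun T => sum_nonneg fun w _ => by split_ifs <;> positivity, fun j => ?_⟩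
    have hcount : (2 : ℝ) * #{w : Fin k → ZMod 2 | w ⬝ᵥ φ (Fin.castLE hqm j) ≠ 0} = 2 ^ k :=
      mod_cast two_mul_card_dotProduct_ne_zero (hφ (Fin.castLE hqm j))
    have hsum := sum_pushforward_const_mul t c fun T => if j ∈ T then 1 else 0
    simp only [mul_ite, mul_one, mul_zero] at hsum
    rw [sum_filter, hsum, ← sum_filter, sum_const, nsmul_eq_mul]
    simp only [t, mem_filter, mem_univ, true_and]
    refine le_of_eq ?_
    simp only [c]
    rw [mul_div_assoc', mul_comm, hcount, div_self (by positivity)]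
  have hle := hclose _ P hP _ hα
  rw [sum_pushforward_const_mul t c fun T => (coverNumber φ (T.biUnion P) : ℝ)] at hle
  have hone : ∀ w, (coverNumber φ ((t w).biUnion P) : ℝ) ≤ 1 := by
    intro w
    have : coverNumber φ ((t w).biUnion P) ≤ #{w} := by
      refine coverNumber_le {w} fun i hi => ⟨w, mem_singleton_self w, ?_⟩
      obtain ⟨l, hl, hil⟩ := mem_biUnion.mp hi
      rw [mem_singleton.mp hil]
      exact (mem_filter.mp hl).2
    exact_mod_cast this
  have hupper : ∑ w, c * (coverNumber φ ((t w).biUnion P) : ℝ) ≤ 2 := by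
    calc ∑ w, c * (coverNumber φ ((t w).biUnion P) : ℝ)
        ≤ ∑ _w : Fin k → ZMod 2, c * 1 :=
          sum_le_sum fun w _ => mul_le_mul_of_nonneg_left (hone w) (by positivity)
      _ = 2 := by simp [c, ZMod.card]; field_simp
  have hlower : (k : ℝ) ≤ coverNumber φ (univ.biUnion P) := by
    refine mod_cast le_coverNumber hφ fun u hu => ?_
    obtain ⟨i, hi⟩ := hsurj u hu
    exact ⟨_, mem_biUnion.mpr ⟨i, mem_univ i, mem_singleton_self _⟩, hi⟩
  have hq2 : (2 : ℝ) < q := mod_cast hq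
  have hlog0 : 0 < Real.logb 2 ((q : ℝ) / 2) := Real.logb_pos one_lt_two (by linarith)
  have hlogk : Real.logb 2 ((q : ℝ) / 2) ≤ k := by
    rw [Real.logb_le_iff_le_rpow one_lt_two (by linarith), Real.rpow_natCast]
    have : (q : ℝ) < 2 ^ (k + 1) := mod_cast hqk
    rw [pow_succ] at this
    linarith
  have hγ0 : 0 < γ := (div_pos two_pos hlog0).trans hγ
  have h2 : 2 < γ * Real.logb 2 ((q : ℝ) / 2) := (div_lt_iff₀ hlog0).mp hγ
  have h3 := mul_le_mul_of_nonneg_left (hlogk.trans hlower) hγ0.le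
  linarith
end
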